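/- arXiv:1806.10691 — 6 statements merged into one kernel-verified Lean document; each statement's English description precedes it below -/
import Mathlib

section
/- If X is a nondegenerate unicoherent Peano continuum without free arcs, then S(X) ∩ CB(X) belongs to the class D_2(F_σ), i.e., it is the difference of two F_σ-subsets of C(X). -/
open Set Topology Metric

noncomputable section

/-- The hyperspace `2^X` of nonempty compact (= closed, for compact `X`) subsets of `X`,
with the Hausdorff metric. -/
abbrev Hyper (X : Type*) [MetricSpace X] := TopologicalSpace.NonemptyCompacts X

/-- `C(X)`: the subcontinua of `X`, i.e. the connected members of the hyperspace. -/
def CSet (X : Type*) [MetricSpace X] : Set (Hyper X) :=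
  {A | IsConnected (A : Set X)}

/-- `CB(X)`: proper subcontinua of `X` with connected boundary. -/
def CBSet (X : Type*) [MetricSpace X] : Set (Hyper X) :=
  {A | IsConnected (A : Set X) ∧ (A : Set X) ≠ Set.univ ∧
    IsConnected (frontier (A : Set X))}

/-- `S(X)`: the members of the hyperspace that separate `X`,
i.e. whose complement is disconnected. -/
def SepSet (X : Type*) [MetricSpace X] : Set (Hyper X) :=
  {A | ¬ IsPreconnected ((A : Set X)ᶜ)}

/-- A set is `F_σ` if it is a countable union of closed sets. -/
def IsFsigma {α : Type*} [TopologicalSpace α] (s : Set α) : Prop :=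
  ∃ F : ℕ → Set α, (∀ n, IsClosed (F n)) ∧ s = ⋃ n, F n

/-- A set is `F_σδ` if it is a countable intersection of `F_σ` sets. -/
def IsFsigmaDelta {α : Type*} [TopologicalSpace α] (s : Set α) : Prop :=
  ∃ F : ℕ → Set α, (∀ n, IsFsigma (F n)) ∧ s = ⋂ n, F n

/-- A set is in the class `D_2(F_σ)` if it is a difference of two `F_σ` sets. -/
def IsD2Fsigma {α : Type*} [TopologicalSpace α] (s : Set α) : Prop :=
  ∃ u v : Set α, IsFsigma u ∧ IsFsigma v ∧ s = u \ v

/-- `X` is unicoherent: the intersection of any two closed connected sets covering `X`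
is connected. -/
def Unicoherent (X : Type*) [TopologicalSpace X] : Prop :=
  ∀ A B : Set X, IsClosed A → IsClosed B → IsConnected A → IsConnected B →
    A ∪ B = Set.univ → IsConnected (A ∩ B)

/-- An arc: a subspace homeomorphic to `[0,1]`. -/
def IsArc {X : Type*} [TopologicalSpace X] (A : Set X) : Prop :=
  Nonempty (unitInterval ≃ₜ A)

/-- A free arc: an arc which becomes open after removing its two endpoints. -/
def IsFreeArc {X : Type*} [TopologicalSpace X] (A : Set X) : Prop :=
  ∃ h : unitInterval ≃ₜ A, IsOpen (A \ {((h 0 : A) : X), ((h 1 : A) : X)})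

/-- `Y` is π-`n`-Euclidean: it has a π-base consisting of open sets homeomorphic to `ℝⁿ`. -/
def PiEuclidean (Y : Type*) [TopologicalSpace Y] (n : ℕ) : Prop :=
  ∃ 𝓤 : Set (Set Y),
    (∀ U ∈ 𝓤, IsOpen U ∧ U.Nonempty ∧ Nonempty (U ≃ₜ (Fin n → ℝ))) ∧
    ∀ V : Set Y, IsOpen V → V.Nonempty → ∃ U ∈ 𝓤, U ⊆ V

/-- The Hilbert cube `I^∞ = [0,1]^ℕ`. -/
abbrev Iinf : Type := ℕ → unitInterval

/-- The pseudo-interior `(0,1)^∞` of the Hilbert cube. -/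
def pseudoInterior : Set Iinf := {t | ∀ k, 0 < (t k : ℝ) ∧ (t k : ℝ) < 1}

/-- The pseudo-boundary `∂(I^∞) = I^∞ \ (0,1)^∞` of the Hilbert cube. -/
def pseudoBoundary : Set Iinf := pseudoInteriorᶜ

/-- A `Z`-set in a (Hilbert cube) metric space `Q`: a closed set `A` such that for every
`ε > 0` the identity can be `ε`-approximated by a map avoiding `A`. -/
def IsZSet {Q : Type*} [MetricSpace Q] (A : Set Q) : Prop :=
  IsClosed A ∧ ∀ ε : ℝ, 0 < ε →
    ∃ f : Q → Q, Continuous f ∧ (∀ x, dist (f x) x < ε) ∧ ∀ x, f x ∉ A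

/-- A `σZ`-set: a countable union of `Z`-sets. -/
def IsSigmaZSet {Q : Type*} [MetricSpace Q] (A : Set Q) : Prop :=
  ∃ Z : ℕ → Set Q, (∀ n, IsZSet (Z n)) ∧ A = ⋃ n, Z n

/-- `A ⊆ Q` is strongly `𝓜`-universal (for a class `𝓜` of subsets of the Hilbert cube
`I^∞`): every embedding `f : I^∞ → Q` sending a compact set `K` onto a `Z`-set can be
approximated by an embedding `g` onto a `Z`-set which agrees with `f` on `K` and with
`g⁻¹(A) \ K = M \ K`. -/
def StronglyUniversal {Q : Type*} [MetricSpace Q] (𝓜 : Set (Set Iinf)) (A : Set Q) : Prop :=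
  ∀ M ∈ 𝓜, ∀ K : Set Iinf, IsCompact K →
    ∀ f : Iinf → Q, IsEmbedding f → IsZSet (f '' K) →
      ∀ ε : ℝ, 0 < ε →
        ∃ g : Iinf → Q, IsEmbedding g ∧ IsZSet (Set.range g) ∧
          (∀ x, dist (g x) (f x) < ε) ∧ (∀ x ∈ K, g x = f x) ∧
          g ⁻¹' A \ K = M \ K

/-- Lebesgue covering dimension `≤ n`: every open cover has an open refinement which
covers and such that each point lies in at most `n + 1` members. -/
def CoveringDimLE (α : Type*) [TopologicalSpace α] (n : ℕ) : Prop :=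
  ∀ 𝓤 : Set (Set α), (∀ U ∈ 𝓤, IsOpen U) → ⋃₀ 𝓤 = Set.univ →
    ∃ 𝓥 : Set (Set α), (∀ V ∈ 𝓥, IsOpen V) ∧ ⋃₀ 𝓥 = Set.univ ∧
      (∀ V ∈ 𝓥, ∃ U ∈ 𝓤, V ⊆ U) ∧
      ∀ (x : α) (s : Finset (Set α)), ↑s ⊆ 𝓥 → (∀ V ∈ s, x ∈ V) → s.card ≤ n + 1

/-- An indecomposable continuum: not the union of two proper subcontinua. -/
def IndecomposableCont (X : Type*) [TopologicalSpace X] : Prop :=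
  ¬ ∃ A B : Set X, IsClosed A ∧ IsClosed B ∧ IsConnected A ∧ IsConnected B ∧
    A ≠ Set.univ ∧ B ≠ Set.univ ∧ A ∪ B = Set.univ

open TopologicalSpace in
lemma isFsigma_of_isGdelta_compl {α : Type*} [TopologicalSpace α] {s : Set α}
    (h : IsGδ sᶜ) : IsFsigma s := by
  obtain ⟨f, hf, he⟩ := h.eq_iInter_nat
  refine ⟨fun n => (f n)ᶜ, fun n => (hf n).isClosed_compl, ?_⟩
  rw [← compl_compl s, he, compl_iInter]

/-- A countable family of open sets interpolating between compact and open sets. -/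
lemma exists_countable_interp (X : Type*) [TopologicalSpace X] [SecondCountableTopology X] :
    ∃ 𝒰 : Set (Set X), 𝒰.Countable ∧ (∀ U ∈ 𝒰, IsOpen U) ∧
      ∀ K O : Set X, IsCompact K → IsOpen O → K ⊆ O → ∃ U ∈ 𝒰, K ⊆ U ∧ U ⊆ O := by
  have hB := TopologicalSpace.isBasis_countableBasis X
  refine ⟨sUnion '' {s | s.Finite ∧ s ⊆ TopologicalSpace.countableBasis X},
    (countable_setOf_finite_subset (TopologicalSpace.countable_countableBasis X)).image _, ?_, ?_⟩
  · rintro _ ⟨s, ⟨-, hs⟩, rfl⟩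
    exact isOpen_sUnion fun t ht => hB.isOpen (hs ht)
  · intro K O hK hO hKO
    obtain ⟨t, ht, htf, htK⟩ := hK.elim_finite_subcover_image
      (b := {B | B ∈ TopologicalSpace.countableBasis X ∧ B ⊆ O}) (c := id)
      (fun B hB' => hB.isOpen hB'.1) (by
        intro x hx
        obtain ⟨B, hB1, hxB, hBO⟩ := hB.exists_subset_of_mem_open (hKO hx) hO
        exact mem_biUnion (show B ∈ {B | B ∈ TopologicalSpace.countableBasis X ∧ B ⊆ O} from
          ⟨hB1, hBO⟩) hxB)
    refine ⟨⋃₀ t, ⟨t, ⟨htf, fun B hB' => (ht hB').1⟩, rfl⟩, ?_, ?_⟩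
    · rw [sUnion_eq_biUnion]; exact htK
    · exact sUnion_subset fun B hB' => (ht hB').2

lemma meets_frontier {X : Type*} [TopologicalSpace X] {W A : Set X} (hW : IsPreconnected W)
    (hA : IsClosed A) (h1 : (A ∩ W).Nonempty) (h2 : ¬ W ⊆ A) : (frontier A ∩ W).Nonempty := by
  by_contra hne
  rw [not_nonempty_iff_eq_empty] at hne
  have hsub : W ⊆ interior A ∪ Aᶜ := by
    intro x hx
    by_contra hx'
    simp only [mem_union, mem_compl_iff, not_or, not_not] at hx'
    have : x ∈ frontier A ∩ W := ⟨by rw [hA.frontier_eq]; exact ⟨hx'.2, hx'.1⟩, hx⟩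
    rw [hne] at this
    exact this
  obtain ⟨a, haA, haW⟩ := h1
  obtain ⟨b, hbW, hbA⟩ := not_subset.1 h2
  obtain ⟨c, -, hc1, hc2⟩ := hW _ _ isOpen_interior hA.isOpen_compl hsub
    ⟨a, haW, (hsub haW).resolve_right (fun h => h haA)⟩ ⟨b, hbW, hbA⟩
  exact hc2 (interior_subset hc1)

lemma isOpen_frontier_meets {X : Type*} [MetricSpace X] [LocallyConnectedSpace X]
    {U : Set X} (hU : IsOpen U) : IsOpen {A : Hyper X | (frontier (A : Set X) ∩ U).Nonempty} := by
  rw [isOpen_iff_mem_nhds]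
  rintro A ⟨x, hxf, hxU⟩
  have hWo : IsOpen (connectedComponentIn U x) := hU.connectedComponentIn
  have hxW : x ∈ connectedComponentIn U x := mem_connectedComponentIn hxU
  have hAc : IsClosed (A : Set X) := A.isCompact.isClosed
  rw [hAc.frontier_eq] at hxf
  have h1 : {K : Hyper X | (↑K ∩ connectedComponentIn U x).Nonempty} ∈ 𝓝 A :=
    (TopologicalSpace.NonemptyCompacts.isOpen_inter_nonempty_of_isOpen hWo).mem_nhds ⟨x, hxf.1, hxW⟩
  obtain ⟨y, hyW, hyA⟩ : ∃ y ∈ connectedComponentIn U x, y ∉ (A : Set X) := by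
    by_contra! h
    exact hxf.2 (mem_interior.2 ⟨_, h, hWo, hxW⟩)
  have h2 : {K : Hyper X | (K : Set X) ⊆ {y}ᶜ} ∈ 𝓝 A :=
    (TopologicalSpace.NonemptyCompacts.isOpen_subsets_of_isOpen isOpen_compl_singleton).mem_nhds
      (fun z hz hzy => hyA (by rw [mem_singleton_iff] at hzy; exact hzy ▸ hz))
  filter_upwards [h1, h2] with K hK1 hK2
  obtain ⟨z, hz1, hz2⟩ := meets_frontier isPreconnected_connectedComponentIn
    K.isCompact.isClosed hK1 (fun h => hK2 (h hyW) rfl)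
  exact ⟨z, hz1, connectedComponentIn_subset _ _ hz2⟩

lemma exists_closed_component {X : Type*} [MetricSpace X] [LocallyConnectedSpace X]
    {A : Set X} (hA : IsClosed A) (hne : A.Nonempty) {p q : X}
    (hq : q ∈ connectedComponentIn Aᶜ p) :
    ∃ C F : Set X, IsPreconnected C ∧ p ∈ C ∧ q ∈ C ∧ C ⊆ F ∧ IsClosed F ∧ F ⊆ Aᶜ := by
  have hp : p ∈ Aᶜ := by
    by_contra h
    rw [connectedComponentIn_eq_empty h] at hq
    exact hq
  let G : ℕ → Set X := fun n => {x | 1 / ((n : ℝ) + 1) < infDist x A}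
  have hGo : ∀ n, IsOpen (G n) := fun n => isOpen_lt continuous_const (continuous_infDist_pt A)
  have hGm : Monotone G := fun m n hmn x hx =>
    show 1 / ((n : ℝ) + 1) < infDist x A from
      lt_of_le_of_lt (Nat.one_div_le_one_div hmn) (show 1 / ((m : ℝ) + 1) < infDist x A from hx)
  have hGex : ∀ x ∈ Aᶜ, ∃ n, x ∈ G n := fun x hx =>
    exists_nat_one_div_lt ((hA.notMem_iff_infDist_pos hne).1 hx)
  let E : Set X := ⋃ n, connectedComponentIn (G n) p
  have hEo : IsOpen E := isOpen_iUnion fun n => (hGo n).connectedComponentIn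
  let E' : Set X := {x | ∃ W, IsOpen W ∧ x ∈ W ∧ Disjoint W E}
  have hE'o : IsOpen E' := by
    rw [isOpen_iff_mem_nhds]
    rintro x ⟨W, hW, hx, hd⟩
    exact Filter.mem_of_superset (hW.mem_nhds hx) fun y hy => ⟨W, hW, hy, hd⟩
  have hqE : q ∈ E := by
    by_contra hqE
    have key : ∀ x ∈ Aᶜ, x ∉ E → x ∈ E' := by
      intro x hx hxE
      obtain ⟨n, hn⟩ := hGex x hx
      refine ⟨connectedComponentIn (G n) x, (hGo n).connectedComponentIn,
        mem_connectedComponentIn hn, ?_⟩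
      rw [disjoint_left]
      intro y hy hyE
      obtain ⟨m, hm⟩ := mem_iUnion.1 hyE
      apply hxE
      have e1 : y ∈ connectedComponentIn (G (max m n)) x :=
        connectedComponentIn_mono x (hGm (le_max_right m n)) hy
      have e2 : y ∈ connectedComponentIn (G (max m n)) p :=
        connectedComponentIn_mono p (hGm (le_max_left m n)) hm
      refine mem_iUnion.2 ⟨max m n, ?_⟩
      rw [connectedComponentIn_eq e2, ← connectedComponentIn_eq e1]
      exact mem_connectedComponentIn (hGm (le_max_right m n) hn)
    obtain ⟨n, hn⟩ := hGex p hp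
    obtain ⟨z, -, hz1, W, -, hzW, hd⟩ :=
      isPreconnected_connectedComponentIn (x := p) (F := Aᶜ) E E' hEo hE'o
      (fun x hx => or_iff_not_imp_left.2 (key x (connectedComponentIn_subset _ _ hx)))
      ⟨p, mem_connectedComponentIn hp, mem_iUnion.2 ⟨n, mem_connectedComponentIn hn⟩⟩
      ⟨q, hq, key q (connectedComponentIn_subset _ _ hq) hqE⟩
    exact disjoint_left.1 hd hzW hz1
  obtain ⟨n, hn⟩ := mem_iUnion.1 hqE
  have hpn : p ∈ G n := by
    by_contra h
    rw [connectedComponentIn_eq_empty h] at hn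
    exact hn
  refine ⟨connectedComponentIn (G n) p, {x | 1 / ((n : ℝ) + 1) ≤ infDist x A},
    isPreconnected_connectedComponentIn, mem_connectedComponentIn hpn, hn,
    fun x hx => show 1 / ((n : ℝ) + 1) ≤ infDist x A from
      le_of_lt (show 1 / ((n : ℝ) + 1) < infDist x A from
        connectedComponentIn_subset (G n) p hx),
    isClosed_le continuous_const (continuous_infDist_pt A), ?_⟩
  intro x hx
  exact (hA.notMem_iff_infDist_pos hne).2 (lt_of_lt_of_le Nat.one_div_pos_of_nat hx)

lemma isOpen_joined {X : Type*} [MetricSpace X] [LocallyConnectedSpace X] (p q : X) :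
    IsOpen {A : Hyper X | q ∈ connectedComponentIn (A : Set X)ᶜ p} := by
  rw [isOpen_iff_mem_nhds]
  intro A hA
  obtain ⟨C, F, hC, hp, hq, hCF, hF, hFA⟩ :=
    exists_closed_component A.isCompact.isClosed A.nonempty hA
  filter_upwards [(TopologicalSpace.NonemptyCompacts.isOpen_subsets_of_isOpen
    hF.isOpen_compl).mem_nhds (show (A : Set X) ⊆ Fᶜ from subset_compl_comm.1 hFA)] with K hK
  exact hC.subset_connectedComponentIn hp (hCF.trans (subset_compl_comm.1 hK)) hq

lemma isOpen_notMem {X : Type*} [MetricSpace X] (p : X) :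
    IsOpen {A : Hyper X | p ∉ (A : Set X)} := by
  convert TopologicalSpace.NonemptyCompacts.isOpen_subsets_of_isOpen
    (isOpen_compl_singleton (x := p)) using 3
  exact subset_compl_singleton_iff.symm

lemma isGdelta_SepSet_compl (X : Type*) [MetricSpace X] [CompactSpace X]
    [LocallyConnectedSpace X] : IsGδ (SepSet X)ᶜ := by
  obtain ⟨D, hDc, hDd⟩ := TopologicalSpace.exists_countable_dense X
  have : Countable D := hDc.to_subtype
  have e : (SepSet X)ᶜ = ⋂ p : D, ⋂ q : D, ({A : Hyper X | (p : X) ∉ (A : Set X)}ᶜ ∪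
      {A : Hyper X | (q : X) ∉ (A : Set X)}ᶜ) ∪
      {A : Hyper X | (q : X) ∈ connectedComponentIn (A : Set X)ᶜ p} := by
    ext A
    simp only [SepSet, mem_compl_iff, mem_setOf_eq, not_not, mem_iInter, mem_union]
    constructor
    · intro h p q
      by_cases hp : (p : X) ∈ (A : Set X)
      · exact .inl (.inl hp)
      by_cases hq : (q : X) ∈ (A : Set X)
      · exact .inl (.inr hq)
      exact .inr (h.subset_connectedComponentIn hp subset_rfl hq)
    · intro h
      have hAo : IsOpen (A : Set X)ᶜ := A.isCompact.isClosed.isOpen_compl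
      refine isPreconnected_of_forall_pair fun x hx y hy => ?_
      obtain ⟨p, hp, hpD⟩ := hDd.inter_open_nonempty _ (hAo.connectedComponentIn (x := x))
        ⟨x, mem_connectedComponentIn hx⟩
      obtain ⟨q, hq, hqD⟩ := hDd.inter_open_nonempty _ (hAo.connectedComponentIn (x := y))
        ⟨y, mem_connectedComponentIn hy⟩
      have hpq : q ∈ connectedComponentIn (A : Set X)ᶜ p := by
        rcases h ⟨p, hpD⟩ ⟨q, hqD⟩ with (h' | h') | h'
        · exact absurd h' (connectedComponentIn_subset _ _ hp)
        · exact absurd h' (connectedComponentIn_subset _ _ hq)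
        · exact h'
      refine ⟨connectedComponentIn (A : Set X)ᶜ x, connectedComponentIn_subset _ _,
        mem_connectedComponentIn hx, ?_, isPreconnected_connectedComponentIn⟩
      rw [connectedComponentIn_eq hp, connectedComponentIn_eq hpq, ← connectedComponentIn_eq hq]
      exact mem_connectedComponentIn hy
  rw [e]
  refine IsGδ.iInter fun p => IsGδ.iInter fun q => ?_
  exact ((isOpen_notMem _).isClosed_compl.isGδ.union (isOpen_notMem _).isClosed_compl.isGδ).union
    (isOpen_joined _ _).isGδ

lemma isGdelta_preconnected_frontier (X : Type*) [MetricSpace X] [CompactSpace X]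
    [LocallyConnectedSpace X] :
    IsGδ {A : Hyper X | IsPreconnected (frontier (A : Set X))} := by
  obtain ⟨𝒰, hc, ho, hi⟩ := exists_countable_interp X
  have : Countable 𝒰 := hc.to_subtype
  let ι := {i : 𝒰 × 𝒰 × 𝒰 × 𝒰 // Disjoint (i.1 : Set X) i.2.1 ∧
    ((i.1 : Set X) ∪ i.2.1) ∪ (i.2.2.1 ∪ i.2.2.2) = univ}
  have e : {A : Hyper X | IsPreconnected (frontier (A : Set X))} = ⋂ i : ι,
      ({A : Hyper X | (frontier (A : Set X) ∩ i.1.1).Nonempty}ᶜ ∪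
       {A : Hyper X | (frontier (A : Set X) ∩ i.1.2.1).Nonempty}ᶜ) ∪
      ({A : Hyper X | ((i.1.2.2.1 : Set X)) ⊆ A}ᶜ ∪
       {A : Hyper X | (A : Set X) ⊆ (i.1.2.2.2 : Set X)ᶜ}ᶜ) := by
    ext A
    have hAc : IsClosed (A : Set X) := A.isCompact.isClosed
    simp only [mem_compl_iff, mem_setOf_eq, mem_iInter, mem_union]
    constructor
    · rintro h ⟨⟨U, V, P, Q⟩, hd, hu⟩
      by_contra! hcon
      obtain ⟨⟨h1, h2⟩, h3, h4⟩ := hcon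
      obtain ⟨x, -, hx1, hx2⟩ := h U V (ho _ U.2) (ho _ V.2) (by
        intro x hx
        rw [hAc.frontier_eq] at hx
        have hxu : x ∈ ((U : Set X) ∪ V) ∪ (P ∪ Q) := by rw [hu]; trivial
        rcases hxu with h | h | h
        · exact h
        · exact absurd (interior_maximal h3 (ho _ P.2) h) hx.2
        · exact absurd h (h4 hx.1)) h1 h2
      exact disjoint_left.1 hd hx1 hx2
    · intro h
      by_contra hn
      rw [isPreconnected_closed_iff] at hn
      push Not at hn
      obtain ⟨t, t', ht, ht', hsub, ⟨a, ha, hat⟩, ⟨b, hb, hbt⟩, hem⟩ := hn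
      have hfc : IsClosed (frontier (A : Set X)) := isClosed_frontier
      obtain ⟨O, O', hO, hO', hOt, hOt', hdO⟩ := SeparatedNhds.of_isCompact_isCompact
        (hfc.inter ht).isCompact (hfc.inter ht').isCompact (by
          rw [disjoint_left]
          rintro x ⟨hx, hxt⟩ ⟨-, hxt'⟩
          have : x ∈ frontier (A : Set X) ∩ (t ∩ t') := ⟨hx, hxt, hxt'⟩
          rw [hem] at this
          exact this)
      obtain ⟨U, hU, hU1, hU2⟩ := hi _ _ (hfc.inter ht).isCompact hO hOt
      obtain ⟨V, hV, hV1, hV2⟩ := hi _ _ (hfc.inter ht').isCompact hO' hOt'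
      have hK : IsClosed (U ∪ V)ᶜ := ((ho _ hU).union (ho _ hV)).isClosed_compl
      have hfUV : frontier (A : Set X) ⊆ U ∪ V := fun x hx =>
        (hsub hx).imp (fun h => hU1 ⟨hx, h⟩) (fun h => hV1 ⟨hx, h⟩)
      obtain ⟨P, hP, hP1, hP2⟩ := hi ((A : Set X) ∩ (U ∪ V)ᶜ) (interior (A : Set X))
        (hAc.inter hK).isCompact isOpen_interior (by
          rintro x ⟨hx, hxK⟩
          by_contra hxi
          exact hxK (hfUV (by rw [hAc.frontier_eq]; exact ⟨hx, hxi⟩)))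
      obtain ⟨Q, hQ, hQ1, hQ2⟩ := hi ((interior (A : Set X))ᶜ ∩ (U ∪ V)ᶜ) ((A : Set X)ᶜ)
        (isOpen_interior.isClosed_compl.inter hK).isCompact hAc.isOpen_compl (by
          rintro x ⟨hx, hxK⟩ hxA
          exact hxK (hfUV (by rw [hAc.frontier_eq]; exact ⟨hxA, hx⟩)))
      have := h ⟨⟨⟨U, hU⟩, ⟨V, hV⟩, ⟨P, hP⟩, ⟨Q, hQ⟩⟩, hdO.mono hU2 hV2, by
        rw [eq_univ_iff_forall]
        intro x
        by_cases hx : x ∈ U ∪ V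
        · exact .inl hx
        by_cases hxA : x ∈ (A : Set X)
        · exact .inr (.inl (hP1 ⟨hxA, hx⟩))
        · exact .inr (.inr (hQ1 ⟨fun h => hxA (interior_subset h), hx⟩))⟩
      rcases this with (h' | h') | h' | h'
      · exact h' ⟨a, ha, hU1 ⟨ha, hat⟩⟩
      · exact h' ⟨b, hb, hV1 ⟨hb, hbt⟩⟩
      · exact h' (hP2.trans interior_subset)
      · exact h' (subset_compl_comm.1 hQ2)
  rw [e]
  refine IsGδ.iInter fun i => ?_
  refine ((isOpen_frontier_meets (ho _ i.1.1.2)).isClosed_compl.isGδ.union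
    (isOpen_frontier_meets (ho _ i.1.2.1.2)).isClosed_compl.isGδ).union (IsGδ.union ?_ ?_)
  · refine (IsClosed.isOpen_compl (self := ?_)).isGδ
    have : {A : Hyper X | ((i.1.2.2.1 : Set X)) ⊆ A} =
        ⋂ x ∈ (i.1.2.2.1 : Set X), {A : Hyper X | x ∉ (A : Set X)}ᶜ := by
      ext A
      simp [subset_def]
    rw [this]
    exact isClosed_biInter fun x _ => (isOpen_notMem x).isClosed_compl
  · exact (TopologicalSpace.NonemptyCompacts.isClosed_subsets_of_isClosed
      (ho _ i.1.2.2.2.2).isClosed_compl).isOpen_compl.isGδ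

/-- If `X` is a nondegenerate unicoherent Peano continuum without free
arcs, then `S(X) ∩ CB(X)` is a difference of two `F_σ`-subsets of `C(X)`. -/
theorem SepSet_inter_CBSet_isD2Fsigma (X : Type*) [MetricSpace X] [CompactSpace X]
    [ConnectedSpace X] [Nontrivial X] [LocallyConnectedSpace X]
    (huc : Unicoherent X) (hfa : ∀ A : Set X, ¬ IsFreeArc A) :
    IsD2Fsigma ((Subtype.val ⁻¹' (SepSet X ∩ CBSet X)) : Set ↥(CSet X)) := by
  have hpre : ∀ s : Set (Hyper X), IsGδ s → IsGδ ((Subtype.val ⁻¹' s) : Set ↥(CSet X)) := by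
    intro s hs
    obtain ⟨f, hf, rfl⟩ := hs.eq_iInter_nat
    rw [preimage_iInter]
    exact IsGδ.iInter_of_isOpen fun n => (hf n).preimage continuous_subtype_val
  refine ⟨Subtype.val ⁻¹' SepSet X,
    Subtype.val ⁻¹' {A : Hyper X | IsPreconnected (frontier (A : Set X))}ᶜ,
    isFsigma_of_isGdelta_compl (hpre _ (isGdelta_SepSet_compl X)),
    isFsigma_of_isGdelta_compl ?_, ?_⟩
  · rw [← preimage_compl, compl_compl]
    exact hpre _ (isGdelta_preconnected_frontier X)
  · ext ⟨A, hA⟩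
    simp only [mem_preimage, mem_inter_iff, mem_diff, mem_compl_iff, mem_setOf_eq, not_not]
    refine and_congr_right fun hS => ⟨fun h => h.2.2.isPreconnected, fun h => ?_⟩
    have hne : (A : Set X) ≠ univ := by
      intro h
      apply hS
      rw [h, compl_univ]
      exact isPreconnected_empty
    exact ⟨hA, hne, nonempty_frontier_iff.2 ⟨A.nonempty, hne⟩, h⟩
end
end

section
/- If X is a nondegenerate unicoherent Peano continuum without free arcs which contains an open subset homeomorphic to ℝ^n for some n with 2 ≤ n < ∞, then S(X) ∩ CB(X) is D_2(F_σ)-universal in C(X): for each subset M of the Hilbert cube I^∞ which is a difference of two F_σ-sets, there is an embedding f : I^∞ → C(X) such that f^{-1}(S(X) ∩ CB(X)) = M. -/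
open Set Topology Metric

noncomputable section

/-! ### Construction in the model space `ℝ × ℝ × Z` -/

/-- The scaling factors `2^{-k}`. -/
def aa (k : ℕ) : ℝ := (1 / 2) ^ k

lemma aa_pos (k : ℕ) : 0 < aa k := by unfold aa; positivity

lemma aa_le_one (k : ℕ) : aa k ≤ 1 := pow_le_one₀ (by norm_num) (by norm_num)

lemma aa_half {i j : ℕ} (h : i < j) : aa j ≤ aa i / 2 := by
  have h1 : aa j ≤ aa (i + 1) := pow_le_pow_of_le_one (by norm_num) (by norm_num) h
  have h2 : aa (i + 1) = aa i / 2 := by unfold aa; rw [pow_succ]; ring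
  linarith

lemma aa_disj {j k : ℕ} (hjk : j ≠ k) {y : ℝ} (hy : |y - aa k| ≤ aa k / 4) :
    aa j / 8 ≤ |y - aa j| := by
  have hj := aa_pos j
  have hk := aa_pos k
  rw [abs_le] at hy
  rcases lt_or_gt_of_ne hjk with h | h
  · have := aa_half h
    rw [abs_sub_comm]
    exact le_trans (by linarith) (le_abs_self _)
  · have := aa_half h
    exact le_trans (by linarith) (le_abs_self _)

/-- The model space. -/
abbrev EE (m : ℕ) := ℝ × ℝ × (Fin m → ℝ)

/-- The complement of the `k`-th column, inside the box. -/
def DD (a u v t : ℝ) {m : ℕ} (x : EE m) : Prop :=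
  (3 + t) * a ≤ x.1 ∨ a / 8 ≤ ‖x.2.2‖ ∨ a / 8 ≤ |x.2.1 - a| ∨
    (x.1 = 0 ∧ u * (a / 8) ≤ |x.2.1 - a|) ∨
    (a ≤ x.1 ∧ x.1 ≤ 2 * a ∧ v * (a / 8) ≤ |x.2.1 - a|)

/-- The big box. -/
def QQ (m : ℕ) : Set (EE m) := closedBall ((5, 0, 0) : EE m) 5

lemma mem_QQ {m : ℕ} (x : EE m) :
    x ∈ QQ m ↔ (0 ≤ x.1 ∧ x.1 ≤ 10) ∧ |x.2.1| ≤ 5 ∧ ‖x.2.2‖ ≤ 5 := by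
  obtain ⟨s, y, z⟩ := x
  simp only [QQ, mem_closedBall, dist_eq_norm, Prod.norm_def, Prod.fst_sub, Prod.snd_sub,
    sub_zero, max_le_iff, Real.norm_eq_abs]
  rw [abs_le]
  constructor
  · rintro ⟨⟨h1, h2⟩, h3⟩; exact ⟨⟨by linarith, by linarith⟩, h3⟩
  · rintro ⟨⟨h1, h2⟩, h3⟩; exact ⟨⟨by linarith, by linarith⟩, h3⟩

/-- The model continuum. -/
def AA (m : ℕ) (u v t : ℕ → ℝ) : Set (EE m) :=
  {x | x ∈ QQ m ∧ ∀ k, DD (aa k) (u k) (v k) (t k) x}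

lemma isClosed_DD (a u v t : ℝ) (m : ℕ) : IsClosed {x : EE m | DD a u v t x} := by
  simp only [DD, setOf_or, setOf_and]
  refine IsClosed.union ?_ (IsClosed.union ?_ (IsClosed.union ?_ (IsClosed.union
    (IsClosed.inter ?_ ?_) (IsClosed.inter ?_ (IsClosed.inter ?_ ?_)))))
  · exact isClosed_le (by fun_prop) (by fun_prop)
  · exact isClosed_le (by fun_prop) (by fun_prop)
  · exact isClosed_le (by fun_prop) (by fun_prop)
  · exact isClosed_eq (by fun_prop) (by fun_prop)
  · exact isClosed_le (by fun_prop) (by fun_prop)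
  · exact isClosed_le (by fun_prop) (by fun_prop)
  · exact isClosed_le (by fun_prop) (by fun_prop)
  · exact isClosed_le (by fun_prop) (by fun_prop)

lemma isCompact_AA (m : ℕ) (u v t : ℕ → ℝ) : IsCompact (AA m u v t) := by
  have h : AA m u v t = QQ m ∩ ⋂ k, {x | DD (aa k) (u k) (v k) (t k) x} := by
    ext x; simp [AA]
  rw [h]
  exact (isCompact_closedBall _ _).inter_right (isClosed_iInter fun k => isClosed_DD _ _ _ _ _)

/-- The parameter is admissible. -/
def Unit01 (u : ℕ → ℝ) : Prop := ∀ k, 0 ≤ u k ∧ u k ≤ 1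

lemma deep_mem {m : ℕ} {u v t : ℕ → ℝ} (ht : Unit01 t) {x : EE m} (hx : x ∈ QQ m)
    (h4 : 4 ≤ x.1) : x ∈ AA m u v t := by
  refine ⟨hx, fun k => Or.inl ?_⟩
  have := ht k
  have h1 := aa_pos k
  have h2 := aa_le_one k
  nlinarith

lemma convex_deep (m : ℕ) : Convex ℝ {x : EE m | x ∈ QQ m ∧ 4 ≤ x.1} := by
  refine (convex_closedBall _ _).inter ?_
  exact convex_halfSpace_ge (f := fun x : EE m => x.1) (IsLinearMap.mk (fun _ _ => rfl) (fun _ _ => rfl)) 4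

/-- Going straight down. -/
lemma down_preconn {m : ℕ} {u v t : ℕ → ℝ} (ht : Unit01 t) {x : EE m} (hx : x ∈ QQ m)
    (h : ∀ j, (3 + t j) * aa j ≤ x.1 ∨ aa j / 8 ≤ ‖x.2.2‖ ∨ aa j / 8 ≤ |x.2.1 - aa j|) :
    ∃ T, T ⊆ AA m u v t ∧ ((10, 0, 0) : EE m) ∈ T ∧ x ∈ T ∧ IsPreconnected T := by
  have hx' := (mem_QQ x).1 hx
  let γ : ℝ → EE m := fun r => (r, x.2.1, x.2.2)
  have hγ : Continuous γ := by fun_prop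
  refine ⟨γ '' Icc x.1 10 ∪ {x : EE m | x ∈ QQ m ∧ 4 ≤ x.1}, ?_, ?_, ?_, ?_⟩
  · rintro p (⟨r, hr, rfl⟩ | hp)
    · refine ⟨(mem_QQ _).2 ⟨⟨hx'.1.1.trans hr.1, hr.2⟩, hx'.2⟩, fun j => ?_⟩
      rcases h j with h | h | h
      · exact Or.inl (h.trans hr.1)
      · exact Or.inr (Or.inl h)
      · exact Or.inr (Or.inr (Or.inl h))
    · exact deep_mem ht hp.1 hp.2
  · right
    refine ⟨(mem_QQ _).2 ?_, ?_⟩ <;> simp <;> norm_num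
  · left
    exact ⟨x.1, ⟨le_rfl, hx'.1.2⟩, rfl⟩
  · refine IsPreconnected.union (γ 10) ⟨10, ⟨hx'.1.2, le_rfl⟩, rfl⟩ ?_
      (isPreconnected_Icc.image _ hγ.continuousOn) (convex_deep m).isPreconnected
    refine ⟨(mem_QQ _).2 ⟨by simp [γ], hx'.2⟩, ?_⟩
    simp only [γ]; norm_num

lemma QQ_of_near {m : ℕ} {k : ℕ} {s y : ℝ} {z : Fin m → ℝ} (h0 : 0 ≤ s) (h1 : s ≤ 10)
    (hy : |y - aa k| ≤ aa k) (hz : ‖z‖ ≤ aa k) : ((s, y, z) : EE m) ∈ QQ m := by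
  have h2 := aa_pos k
  have h3 := aa_le_one k
  rw [abs_le] at hy
  refine (mem_QQ _).2 ⟨⟨h0, h1⟩, abs_le.2 ⟨?_, ?_⟩, ?_⟩ <;> simp only <;> linarith

lemma isConnected_AA (m : ℕ) (u v t : ℕ → ℝ) (hu : Unit01 u) (hv : Unit01 v) (ht : Unit01 t) :
    IsConnected (AA m u v t) := by
  have hb : ((10, 0, 0) : EE m) ∈ AA m u v t :=
    deep_mem ht ((mem_QQ _).2 (by simp)) (by norm_num)
  refine ⟨⟨_, hb⟩, isPreconnected_of_forall (10, 0, 0) fun x hx => ?_⟩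
  by_cases h : ∀ j, (3 + t j) * aa j ≤ x.1 ∨ aa j / 8 ≤ ‖x.2.2‖ ∨ aa j / 8 ≤ |x.2.1 - aa j|
  · exact down_preconn ht hx.1 h
  push Not at h
  obtain ⟨k, h1, h2, h3⟩ := h
  have hk := aa_pos k
  have hx' := (mem_QQ x).1 hx.1
  -- choose the exit point
  obtain ⟨y', hy1, hy2⟩ : ∃ y', |y' - aa k| = aa k / 8 ∧
      ∀ r ∈ Icc (0 : ℝ) 1, |x.2.1 - aa k| ≤ |x.2.1 + r * (y' - x.2.1) - aa k| ∧
        |x.2.1 + r * (y' - x.2.1) - aa k| ≤ aa k / 8 := by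
    rcases le_total 0 (x.2.1 - aa k) with hs | hs
    · refine ⟨aa k + aa k / 8, by rw [add_sub_cancel_left, abs_of_pos (by linarith)], fun r hr => ?_⟩
      obtain ⟨hr0, hr1⟩ := hr
      rw [abs_of_nonneg hs] at h3 ⊢
      have e : x.2.1 + r * (aa k + aa k / 8 - x.2.1) - aa k
        = (x.2.1 - aa k) + r * (aa k / 8 - (x.2.1 - aa k)) := by ring
      rw [e, abs_of_nonneg (by nlinarith)]
      constructor <;> nlinarith
    · refine ⟨aa k - aa k / 8, by rw [abs_of_neg (by linarith)]; ring, fun r hr => ?_⟩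
      obtain ⟨hr0, hr1⟩ := hr
      rw [abs_of_nonpos hs] at h3 ⊢
      have e : x.2.1 + r * (aa k - aa k / 8 - x.2.1) - aa k
        = -(-(x.2.1 - aa k) + r * (aa k / 8 + (x.2.1 - aa k))) := by ring
      rw [e, abs_neg, abs_of_nonneg (by nlinarith)]
      constructor <;> nlinarith
  let γ : ℝ → EE m := fun r => (x.1, x.2.1 + r * (y' - x.2.1), x.2.2)
  have hγ : Continuous γ := by fun_prop
  have hQ : ∀ r ∈ Icc (0 : ℝ) 1, γ r ∈ QQ m := fun r hr =>
    QQ_of_near hx'.1.1 hx'.1.2 ((hy2 r hr).2.trans (by linarith)) (by linarith)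
  have h11 : (1 : ℝ) ∈ Icc (0 : ℝ) 1 := by simp
  have h00 : (0 : ℝ) ∈ Icc (0 : ℝ) 1 := by simp
  obtain ⟨T, hT1, hT2, hT3, hT4⟩ := down_preconn (u := u) (v := v) ht (hQ 1 h11) (by
    intro j
    right; right
    by_cases hj : j = k
    · subst hj
      simp only [γ]
      rw [one_mul, add_sub_cancel, hy1]
    · exact aa_disj hj ((hy2 1 h11).2.trans (by linarith)))
  refine ⟨T ∪ γ '' Icc 0 1, union_subset hT1 ?_, Or.inl hT2, Or.inr ⟨0, h00, by simp [γ]⟩,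
    IsPreconnected.union (γ 1) hT3 ⟨1, h11, rfl⟩ hT4 (isPreconnected_Icc.image _ hγ.continuousOn)⟩
  rintro _ ⟨r, hr, rfl⟩
  refine ⟨hQ r hr, fun j => ?_⟩
  by_cases hj : j = k
  · subst hj
    have := hy2 r hr
    rcases hx.2 j with h | h | h | h | h
    · exact absurd h (not_le.2 h1)
    · exact absurd h (not_le.2 h2)
    · exact absurd h (not_le.2 h3)
    · exact Or.inr (Or.inr (Or.inr (Or.inl ⟨h.1, h.2.trans this.1⟩)))
    · exact Or.inr (Or.inr (Or.inr (Or.inr ⟨h.1, h.2.1, h.2.2.trans this.1⟩)))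
  · exact Or.inr (Or.inr (Or.inl (aa_disj hj ((hy2 r hr).2.trans (by linarith)))))

/-- Pushing a coordinate out. -/
lemma push_out {y c ρ ρ' : ℝ} (hρ' : 0 ≤ ρ') (h1 : ρ ≤ |y - c|) (h2 : |y - c| < ρ') :
    ∃ y', |y' - c| = ρ' ∧ |y - y'| ≤ ρ' - ρ := by
  rcases le_total 0 (y - c) with hs | hs
  · rw [abs_of_nonneg hs] at h1 h2
    refine ⟨c + ρ', by rw [add_sub_cancel_left, abs_of_nonneg hρ'], ?_⟩
    rw [abs_le]; constructor <;> linarith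
  · rw [abs_of_nonpos hs] at h1 h2
    refine ⟨c - ρ', by rw [sub_sub_cancel_left, abs_neg, abs_of_nonneg hρ'], ?_⟩
    rw [abs_le]; constructor <;> linarith

lemma AA_close {m : ℕ} {u v t u' v' t' : ℕ → ℝ}
    (hu' : Unit01 u') (hv' : Unit01 v') (ht' : Unit01 t') {δ : ℝ} (hδ : 0 ≤ δ)
    (H : ∀ k, aa k * |u' k - u k| ≤ δ ∧ aa k * |v' k - v k| ≤ δ ∧ aa k * |t' k - t k| ≤ δ)
    {x : EE m} (hx : x ∈ AA m u v t) : ∃ x' ∈ AA m u' v' t', dist x x' ≤ δ := by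
  by_cases hxA : x ∈ AA m u' v' t'
  · exact ⟨x, hxA, by simpa using hδ⟩
  have : ∃ k, ¬ DD (aa k) (u' k) (v' k) (t' k) x := by
    by_contra! h
    exact hxA ⟨hx.1, h⟩
  obtain ⟨k, hk⟩ := this
  have hx' := (mem_QQ x).1 hx.1
  have ha := aa_pos k
  have ha1 := aa_le_one k
  obtain ⟨s, y, z⟩ := x
  simp only [DD, not_or, not_and, not_le] at hk
  obtain ⟨k1, k2, k3, k4, k5⟩ := hk
  obtain ⟨H1, H2, H3⟩ := H k
  have hmove : ∀ s' y', 0 ≤ s' → s' ≤ 10 → |y' - aa k| ≤ aa k / 8 →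
      DD (aa k) (u' k) (v' k) (t' k) ((s', y', z) : EE m) →
      ((s', y', z) : EE m) ∈ AA m u' v' t' := by
    intro s' y' hs0 hs1 hy hD
    refine ⟨QQ_of_near hs0 hs1 (hy.trans (by linarith)) (by linarith), fun j => ?_⟩
    by_cases hj : j = k
    · subst hj; exact hD
    · exact Or.inr (Or.inr (Or.inl (aa_disj hj (hy.trans (by linarith)))))
  have hu := hu' k
  have hv := hv' k
  have ht := ht' k
  have le_abs_u := le_abs_self (u' k - u k)
  have le_abs_v := le_abs_self (v' k - v k)
  have le_abs_t := le_abs_self (t' k - t k)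
  have nn_u := abs_nonneg (u' k - u k)
  have nn_v := abs_nonneg (v' k - v k)
  rcases hx.2 k with h | h | h | h | h
  · refine ⟨((3 + t' k) * aa k, y, z), hmove _ _ (by nlinarith) (by nlinarith) k3.le
      (Or.inl le_rfl), ?_⟩
    simp only [Prod.dist_eq, dist_self, max_le_iff, Real.dist_eq]
    refine ⟨?_, hδ⟩
    simp only at h
    rw [abs_le]; constructor <;> nlinarith
  · exact absurd h (not_le.2 k2)
  · exact absurd h (not_le.2 k3)
  · obtain ⟨y', e1, e2⟩ := push_out (by nlinarith) h.2 (k4 h.1)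
    refine ⟨(s, y', z), hmove _ _ hx'.1.1 hx'.1.2 (by rw [e1]; nlinarith)
      (Or.inr (Or.inr (Or.inr (Or.inl ⟨h.1, e1.ge⟩)))), ?_⟩
    simp only [Prod.dist_eq, dist_self, max_le_iff, Real.dist_eq]
    refine ⟨hδ, e2.trans ?_, hδ⟩
    nlinarith
  · obtain ⟨y', e1, e2⟩ := push_out (by nlinarith) h.2.2 (k5 h.1 h.2.1)
    refine ⟨(s, y', z), hmove _ _ hx'.1.1 hx'.1.2 (by rw [e1]; nlinarith)
      (Or.inr (Or.inr (Or.inr (Or.inr ⟨h.1, h.2.1, e1.ge⟩)))), ?_⟩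
    simp only [Prod.dist_eq, dist_self, max_le_iff, Real.dist_eq]
    refine ⟨hδ, e2.trans ?_, hδ⟩
    nlinarith

/-- The bottom of the `k`-th column lies in the continuum. -/
lemma bottom_mem (m : ℕ) {u v t : ℕ → ℝ} (ht : Unit01 t) (k : ℕ) :
    (((3 + t k) * aa k, aa k, 0) : EE m) ∈ AA m u v t := by
  have ha := aa_pos k
  have ha1 := aa_le_one k
  have h := ht k
  refine ⟨QQ_of_near (k := k) (by nlinarith) (by nlinarith) (by simp [ha.le]) (by simp [ha.le]),
    fun j => ?_⟩
  by_cases hj : j = k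
  · subst hj; exact Or.inl le_rfl
  · exact Or.inr (Or.inr (Or.inl (aa_disj hj (by simp; linarith))))

lemma chamber_notMem (m : ℕ) {u v t : ℕ → ℝ} (k : ℕ) {s y : ℝ} {z : Fin m → ℝ}
    (h1 : 2 * aa k < s) (h2 : s < (3 + t k) * aa k) (hy : |y - aa k| < aa k / 8)
    (hz : ‖z‖ < aa k / 8) : ((s, y, z) : EE m) ∉ AA m u v t := by
  intro h
  have ha := aa_pos k
  rcases h.2 k with h | h | h | h | h
  · exact absurd h (not_le.2 h2)
  · exact absurd h (not_le.2 hz)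
  · exact absurd h (not_le.2 hy)
  · have := h.1; simp only at this; linarith
  · have := h.2.1; simp only at this; linarith

lemma AA_inj (m : ℕ) {u v t u' v' t' : ℕ → ℝ} (ht : Unit01 t) (ht' : Unit01 t')
    (h : AA m u v t = AA m u' v' t') : t = t' := by
  funext k
  have ha := aa_pos k
  have key : ∀ {u v t u' v' t' : ℕ → ℝ}, Unit01 t → Unit01 t' → 
      AA m u v t = AA m u' v' t' → t' k ≤ t k := by
    intro u v t u' v' t' ht ht' h
    by_contra! hlt
    have h1 := bottom_mem m (u := u) (v := v) ht k
    rw [h] at h1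
    have := ht k
    exact chamber_notMem m k (by nlinarith) (by nlinarith) (by simp [ha]) (by simp [ha]) h1
  exact le_antisymm (key ht' ht h.symm) (key ht ht' h)

/-- The `k`-th column: the points of the box removed at stage `k`. -/
def GG (m k : ℕ) (u v t : ℕ → ℝ) : Set (EE m) :=
  {x | x ∈ QQ m ∧ ¬ DD (aa k) (u k) (v k) (t k) x}

lemma GG_preconn (m k : ℕ) (u v t : ℕ → ℝ) (ht : Unit01 t) (hv : 0 < v k) :
    IsPreconnected (GG m k u v t ∪ {((0, aa k, 0) : EE m)}) := by
  have ha := aa_pos k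
  have htk := ht k
  refine isPreconnected_of_forall (0, aa k, 0) fun x hx => ?_
  rcases hx with hx | rfl
  swap
  · exact ⟨{(0, aa k, 0)}, by simp, rfl, rfl, isPreconnected_singleton⟩
  obtain ⟨s, y, z⟩ := x
  obtain ⟨hQ, hD⟩ := hx
  have hx' := (mem_QQ _).1 hQ
  simp only [DD, not_or, not_and, not_le] at hD hx'
  obtain ⟨k1, k2, k3, k4, k5⟩ := hD
  let γ : ℝ → EE m := fun r => (s, aa k + r * (y - aa k), r • z)
  let η : ℝ → EE m := fun r => (r, aa k, 0)
  have hγ : Continuous γ := by fun_prop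
  have hη : Continuous η := by fun_prop
  refine ⟨η '' Icc 0 s ∪ γ '' Icc 0 1, ?_, Or.inl ⟨0, ⟨le_rfl, hx'.1.1⟩, rfl⟩,
    Or.inr ⟨1, by simp, by simp [γ]⟩,
    IsPreconnected.union (γ 0) ⟨s, ⟨hx'.1.1, le_rfl⟩, by simp [γ, η]⟩ ⟨0, by simp, rfl⟩
      (isPreconnected_Icc.image _ hη.continuousOn) (isPreconnected_Icc.image _ hγ.continuousOn)⟩
  rintro _ (⟨r, ⟨hr0, hr1⟩, rfl⟩ | ⟨r, ⟨hr0, hr1⟩, rfl⟩)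
  · rcases hr0.eq_or_lt with rfl | hr0
    · right; rfl
    left
    refine ⟨QQ_of_near (k := k) hr0.le (hr1.trans hx'.1.2) (by simp [ha.le]) (by simp [ha.le]), ?_⟩
    simp only [DD, η, not_or, not_and, not_le, sub_self, abs_zero, norm_zero]
    exact ⟨by linarith, by linarith, by linarith, fun h => absurd h hr0.ne',
      fun _ _ => by positivity⟩
  · left
    have hny : |aa k + r * (y - aa k) - aa k| ≤ |y - aa k| := by
      rw [add_sub_cancel_left, abs_mul, abs_of_nonneg hr0]
      exact mul_le_of_le_one_left (abs_nonneg _) hr1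
    have hnz : ‖r • z‖ ≤ ‖z‖ := by
      rw [norm_smul, Real.norm_eq_abs, abs_of_nonneg hr0]
      exact mul_le_of_le_one_left (norm_nonneg _) hr1
    refine ⟨QQ_of_near (k := k) hx'.1.1 hx'.1.2 (by linarith) (by linarith), ?_⟩
    simp only [DD, γ, not_or, not_and, not_le]
    exact ⟨k1, hnz.trans_lt k2, hny.trans_lt k3, fun h => hny.trans_lt (k4 h),
      fun h h' => hny.trans_lt (k5 h h')⟩

lemma EE_rank (m : ℕ) : 1 < Module.rank ℝ (EE m) := by
  have h : Module.finrank ℝ (EE m) = m + 2 := by simp; ring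
  rw [← Module.finrank_eq_rank, h]
  exact_mod_cast (by omega : 1 < m + 2)

lemma compl_QQ_preconn (m : ℕ) : IsPreconnected ((QQ m)ᶜ) := by
  have e : (QQ m)ᶜ = (fun p : ℝ × EE m => (5, 0, 0) + p.1 • p.2) ''
      (Ioi (5 : ℝ) ×ˢ sphere (0 : EE m) 1) := by
    ext x
    simp only [QQ, mem_compl_iff, mem_closedBall, not_le, mem_image, mem_prod, mem_Ioi,
      mem_sphere_iff_norm, sub_zero, Prod.exists, dist_eq_norm]
    constructor
    · intro h
      have h0 : (0 : ℝ) < ‖x - (5, 0, 0)‖ := by linarith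
      obtain ⟨w, hw⟩ : ∃ w, w = x - (5, 0, 0) := ⟨_, rfl⟩
      rw [← hw] at h h0
      have h2 : (5, 0, 0) + ‖w‖ • (‖w‖⁻¹ • w) = x := by
        rw [smul_inv_smul₀ h0.ne', hw]; abel
      have h1 : ‖‖w‖⁻¹ • w‖ = 1 := by
        rw [norm_smul, norm_inv, norm_norm, inv_mul_cancel₀ h0.ne']
      exact ⟨‖w‖, _, _, _, ⟨h, h1⟩, h2⟩
    · rintro ⟨r, a, b, c, ⟨hr, h1⟩, rfl⟩
      rw [add_sub_cancel_left, norm_smul, h1, mul_one, Real.norm_eq_abs]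
      exact hr.trans_le (le_abs_self _)
  rw [e]
  exact (isPreconnected_Ioi.prod (isPreconnected_sphere (EE_rank m) _ _)).image _
    (by fun_prop)

/-! ### Transfer to `X` -/

section transfer

variable {X : Type*} [MetricSpace X] [CompactSpace X] [ConnectedSpace X]

lemma out_preconn {m : ℕ} {φ : EE m → X} (hφ : IsOpenEmbedding φ) :
    IsPreconnected ((φ '' QQ m)ᶜ) := by
  have hQc : IsClosed (φ '' QQ m) := ((isCompact_closedBall _ _).image hφ.continuous).isClosed
  have hR : IsPreconnected (φ '' (QQ m)ᶜ) :=
    (compl_QQ_preconn m).image _ hφ.continuous.continuousOn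
  have hRsub : φ '' (QQ m)ᶜ ⊆ (φ '' QQ m)ᶜ := by
    rw [image_compl_eq_range_diff_image hφ.injective]
    exact fun x hx => hx.2
  have hRne : (φ '' (QQ m)ᶜ).Nonempty := by
    refine Nonempty.image _ ⟨(-1, 0, 0), ?_⟩
    rw [mem_compl_iff, mem_QQ]; norm_num
  have key : ∀ u v : Set X, IsOpen u → IsOpen v → (φ '' QQ m)ᶜ ⊆ u ∪ v →
      (φ '' QQ m)ᶜ ∩ (u ∩ v) = ∅ → φ '' (QQ m)ᶜ ⊆ u → (φ '' QQ m)ᶜ ⊆ u := by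
    intro u v hu hv huv hd hRu
    have hcl : IsClopen (v ∩ (φ '' QQ m)ᶜ) := by
      refine ⟨?_, hv.inter hQc.isOpen_compl⟩
      have e : (v ∩ (φ '' QQ m)ᶜ)ᶜ = range φ ∪ ((φ '' QQ m)ᶜ ∩ u) := by
        ext x
        constructor
        · intro hx
          by_cases hxQ : x ∈ φ '' QQ m
          · exact Or.inl (image_subset_range _ _ hxQ)
          · rcases huv hxQ with h | h
            · exact Or.inr ⟨hxQ, h⟩
            · exact absurd ⟨h, hxQ⟩ hx
        · rintro hx ⟨hxv, hxQ⟩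
          have hxu : x ∈ u := by
            rcases hx with ⟨p, rfl⟩ | hx
            · exact hRu ⟨p, fun hp => hxQ ⟨p, hp, rfl⟩, rfl⟩
            · exact hx.2
          have : x ∈ (φ '' QQ m)ᶜ ∩ (u ∩ v) := ⟨hxQ, hxu, hxv⟩
          rw [hd] at this
          exact this
      rw [← isOpen_compl_iff, e]
      exact hφ.isOpen_range.union (hQc.isOpen_compl.inter hu)
    rcases isClopen_iff.1 hcl with h | h
    · intro x hx
      rcases huv hx with h' | h'
      · exact h'
      · have : x ∈ v ∩ (φ '' QQ m)ᶜ := ⟨h', hx⟩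
        rw [h] at this
        exact this.elim
    · exfalso
      have hc : ((5, 0, 0) : EE m) ∈ QQ m := mem_closedBall_self (by norm_num)
      have : φ (5, 0, 0) ∈ v ∩ (φ '' QQ m)ᶜ := by rw [h]; trivial
      exact this.2 ⟨_, hc, rfl⟩
  rw [isPreconnected_iff_subset_of_disjoint]
  intro u v hu hv huv hd
  rcases (isPreconnected_iff_subset_of_disjoint.1 hR) u v hu hv (hRsub.trans huv)
    (by
      rw [← subset_empty_iff, ← hd]
      exact inter_subset_inter_left _ hRsub) with h | h
  · exact Or.inl (key u v hu hv huv hd h)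
  · exact Or.inr (key v u hv hu (by rwa [union_comm]) (by rwa [inter_comm v u]) h)

/-- The auxiliary connected set. -/
def TT {m : ℕ} (φ : EE m → X) (u v t : ℕ → ℝ) : Set X :=
  ⋃ k, ((φ '' QQ m)ᶜ ∪ φ '' (GG m k u v t ∪ {((0, aa k, 0) : EE m)}))

lemma top_closure {m : ℕ} {φ : EE m → X} (hφ : IsOpenEmbedding φ) (k : ℕ) :
    φ (0, aa k, 0) ∈ closure ((φ '' QQ m)ᶜ) := by
  have h1 : ((0, aa k, 0) : EE m) ∈ closure ((QQ m)ᶜ) := by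
    have hc : Continuous (fun r : ℝ => ((r, aa k, 0) : EE m)) := by fun_prop
    have h2 : (0 : ℝ) ∈ closure (Iio (0 : ℝ)) := by simp
    refine map_mem_closure (f := fun r : ℝ => ((r, aa k, 0) : EE m)) hc h2 fun r hr => ?_
    rw [mem_compl_iff, mem_QQ]
    intro h
    exact absurd h.1.1 (not_le.2 hr)
  refine map_mem_closure hφ.continuous h1 fun p hp => ?_
  rintro ⟨p', hp', e⟩
  exact hp (hφ.injective e ▸ hp')

lemma TT_preconn {m : ℕ} {φ : EE m → X} (hφ : IsOpenEmbedding φ) {u v t : ℕ → ℝ}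
    (ht : Unit01 t) (hv : ∀ k, 0 < v k) : IsPreconnected (TT φ u v t) := by
  have hne : φ (-1, 0, 0) ∈ (φ '' QQ m)ᶜ := by
    rintro ⟨p', hp', e⟩
    have := hφ.injective e
    subst this
    rw [mem_QQ] at hp'
    norm_num at hp'
  refine isPreconnected_iUnion ⟨_, mem_iInter.2 fun k => Or.inl hne⟩ fun k => ?_
  have h1 : IsPreconnected ((φ '' QQ m)ᶜ ∪ {φ (0, aa k, 0)}) :=
    (out_preconn hφ).subset_closure subset_union_left
      (union_subset subset_closure (by simpa using top_closure hφ k))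
  have h2 := (GG_preconn m k u v t ht (hv k)).image φ hφ.continuous.continuousOn
  have h3 := IsPreconnected.union (φ (0, aa k, 0)) (Or.inr rfl)
    (mem_image_of_mem φ (Or.inr rfl)) h1 h2
  convert h3 using 1
  ext x
  simp only [mem_union, mem_singleton_iff, image_union, image_singleton]
  tauto

lemma compl_AA {m : ℕ} {φ : EE m → X} (hφ : IsOpenEmbedding φ) (u v t : ℕ → ℝ) :
    (φ '' AA m u v t)ᶜ = (φ '' QQ m)ᶜ ∪ ⋃ k, φ '' GG m k u v t := by
  ext x
  constructor
  · intro hx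
    by_cases hQ : x ∈ φ '' QQ m
    · right
      obtain ⟨p, hp, rfl⟩ := hQ
      by_contra! h
      refine hx ⟨p, ⟨hp, fun k => ?_⟩, rfl⟩
      by_contra hk
      exact h (mem_iUnion.2 ⟨k, p, ⟨hp, hk⟩, rfl⟩)
    · exact Or.inl hQ
  · rintro (hx | hx) ⟨p, hp, rfl⟩
    · exact hx ⟨p, hp.1, rfl⟩
    · obtain ⟨k, p', hp', e⟩ := mem_iUnion.1 hx
      have := hφ.injective e
      subst this
      exact hp'.2 (hp.2 k)

lemma compl_subset_TT {m : ℕ} {φ : EE m → X} (hφ : IsOpenEmbedding φ) (u v t : ℕ → ℝ) :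
    (φ '' AA m u v t)ᶜ ⊆ TT φ u v t := by
  rw [compl_AA hφ]
  rintro x (hx | hx)
  · exact mem_iUnion.2 ⟨0, Or.inl hx⟩
  · obtain ⟨k, hk⟩ := mem_iUnion.1 hx
    exact mem_iUnion.2 ⟨k, Or.inr (image_mono subset_union_left hk)⟩

lemma TT_subset_closure {m : ℕ} {φ : EE m → X} (hφ : IsOpenEmbedding φ) (u v t : ℕ → ℝ) :
    TT φ u v t ⊆ closure ((φ '' AA m u v t)ᶜ) := by
  rw [compl_AA hφ]
  refine iUnion_subset fun k => union_subset (subset_union_left.trans subset_closure) ?_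
  rw [image_union, image_singleton]
  refine union_subset ((subset_iUnion (fun k => φ '' GG m k u v t) k).trans
    (subset_union_right.trans subset_closure)) ?_
  rw [singleton_subset_iff]
  exact closure_mono subset_union_left (top_closure hφ k)

lemma TT_eq {m : ℕ} {φ : EE m → X} (hφ : IsOpenEmbedding φ) {u v t : ℕ → ℝ}
    (ht : Unit01 t) (hu : ∀ k, 0 < u k) : TT φ u v t = (φ '' AA m u v t)ᶜ := by
  refine Subset.antisymm ?_ (compl_subset_TT hφ u v t)
  rw [compl_AA hφ]
  refine iUnion_subset fun k => union_subset subset_union_left ?_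
  refine subset_trans ?_ (subset_union_right.trans' (subset_iUnion (fun k => φ '' GG m k u v t) k))
  refine image_mono (union_subset subset_rfl ?_)
  rw [singleton_subset_iff]
  have ha := aa_pos k
  have htk := ht k
  have huk := hu k
  refine ⟨QQ_of_near (k := k) le_rfl (by norm_num) (by simp [ha.le]) (by simp [ha.le]), ?_⟩
  simp only [DD, not_or, not_and, not_le, sub_self, abs_zero, norm_zero]
  exact ⟨by nlinarith, by linarith, by linarith, fun _ => by positivity, fun h => by linarith⟩

/-- Case `u k = 0`: the continuum separates. -/
lemma separates {m : ℕ} {φ : EE m → X} (hφ : IsOpenEmbedding φ) {u v t : ℕ → ℝ}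
    (ht : Unit01 t) {k : ℕ} (hu : u k = 0) : ¬ IsPreconnected ((φ '' AA m u v t)ᶜ) := by
  have ha := aa_pos k
  have ha1 := aa_le_one k
  have htk := ht k
  let N : Set (EE m) := {x | 0 < x.1 ∧ x.1 < (3 + t k) * aa k ∧ |x.2.1 - aa k| < aa k / 8 ∧
    ‖x.2.2‖ < aa k / 8}
  let C : Set (EE m) := {x | x ∈ QQ m ∧ (0 ≤ x.1 ∧ x.1 ≤ (3 + t k) * aa k ∧
    |x.2.1 - aa k| ≤ aa k / 8 ∧ ‖x.2.2‖ ≤ aa k / 8)}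
  have hN : IsOpen N := by
    simp only [N, setOf_and]
    refine IsOpen.inter ?_ (IsOpen.inter ?_ (IsOpen.inter ?_ ?_)) <;>
      exact isOpen_lt (by fun_prop) (by fun_prop)
  have hC : IsCompact C := by
    simp only [C, setOf_and]
    refine (isCompact_closedBall _ _).inter_right
      (IsClosed.inter ?_ (IsClosed.inter ?_ (IsClosed.inter ?_ ?_))) <;>
      exact isClosed_le (by fun_prop) (by fun_prop)
  have hNC : N ⊆ C := by
    rintro ⟨s, y, z⟩ ⟨h1, h2, h3, h4⟩
    simp only at h1 h2 h3 h4
    exact ⟨QQ_of_near (k := k) h1.le (by nlinarith) (by linarith) (by linarith),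
      h1.le, h2.le, h3.le, h4.le⟩
  intro hcon
  rw [isPreconnected_iff_subset_of_disjoint] at hcon
  have hmid : ((5 / 2 * aa k, aa k, 0) : EE m) ∉ AA m u v t :=
    chamber_notMem m k (by linarith) (by nlinarith) (by simp [ha]) (by simp [ha])
  have hmidN : ((5 / 2 * aa k, aa k, 0) : EE m) ∈ N :=
    ⟨by simp only; linarith, by simp only; nlinarith, by simp [ha], by simp [ha]⟩
  have hout : ((-1, 0, 0) : EE m) ∉ QQ m := by rw [mem_QQ]; norm_num
  have hcov : (φ '' AA m u v t)ᶜ ⊆ φ '' N ∪ (φ '' C)ᶜ := by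
    · intro x hx
      by_cases hxC : x ∈ φ '' C
      · left
        obtain ⟨⟨s, y, z⟩, ⟨hpQ, h1, h2, h3, h4⟩, rfl⟩ := hxC
        refine ⟨_, ?_, rfl⟩
        by_contra hpN
        refine hx ⟨_, ⟨hpQ, fun j => ?_⟩, rfl⟩
        by_cases hj : j = k
        · subst hj
          by_contra hD
          simp only [DD, not_or, not_and, not_le, hu, zero_mul] at hD
          obtain ⟨k1, k2, k3, k4, k5⟩ := hD
          refine hpN ⟨lt_of_le_of_ne h1 fun h0 => ?_, k1, k3, k2⟩
          exact absurd (k4 h0.symm) (not_lt.2 (abs_nonneg _))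
        · exact Or.inr (Or.inr (Or.inl (aa_disj hj (h3.trans (by linarith)))))
      · exact Or.inr hxC
  have hdis : (φ '' AA m u v t)ᶜ ∩ (φ '' N ∩ (φ '' C)ᶜ) = ∅ := by
    · rw [← subset_empty_iff]
      rintro x ⟨-, hx1, hx2⟩
      exact hx2 (image_mono hNC hx1)
  rcases hcon (φ '' N) ((φ '' C)ᶜ) (hφ.isOpenMap _ hN)
    (hC.image hφ.continuous).isClosed.isOpen_compl hcov hdis with h | h
  · have h1 : φ (-1, 0, 0) ∈ (φ '' AA m u v t)ᶜ := by
      rintro ⟨p, hp, e⟩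
      exact hout (hφ.injective e ▸ hp.1)
    obtain ⟨p, hp, e⟩ := h h1
    exact hout (hφ.injective e ▸ (hNC hp).1)
  · have h1 : φ (5 / 2 * aa k, aa k, 0) ∈ (φ '' AA m u v t)ᶜ := by
      rintro ⟨p, hp, e⟩
      exact hmid (hφ.injective e ▸ hp)
    exact h h1 ⟨_, hNC hmidN, rfl⟩

/-- Case `v k = 0`: the boundary is disconnected. -/
lemma frontier_disc {m : ℕ} {φ : EE m → X} (hφ : IsOpenEmbedding φ) {u v t : ℕ → ℝ}
    (ht : Unit01 t) {k : ℕ} (hv : v k = 0) : ¬ IsConnected (frontier (φ '' AA m u v t)) := by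
  have ha := aa_pos k
  have ha1 := aa_le_one k
  have htk := ht k
  let N : Set (EE m) := {x | 2 * aa k < x.1 ∧ x.1 < (3 + t k) * aa k ∧ |x.2.1 - aa k| < aa k / 8 ∧
    ‖x.2.2‖ < aa k / 8}
  let C : Set (EE m) := {x | x ∈ QQ m ∧ (2 * aa k ≤ x.1 ∧ x.1 ≤ (3 + t k) * aa k ∧
    |x.2.1 - aa k| ≤ aa k / 8 ∧ ‖x.2.2‖ ≤ aa k / 8)}
  let W : Set (EE m) := {x | 3 / 2 * aa k < x.1 ∧ x.1 < 5 ∧ |x.2.1 - aa k| < aa k / 4 ∧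
    ‖x.2.2‖ < aa k / 4}
  have hW : IsOpen W := by
    simp only [W, setOf_and]
    refine IsOpen.inter ?_ (IsOpen.inter ?_ (IsOpen.inter ?_ ?_)) <;>
      exact isOpen_lt (by fun_prop) (by fun_prop)
  have hC : IsCompact C := by
    simp only [C, setOf_and]
    refine (isCompact_closedBall _ _).inter_right
      (IsClosed.inter ?_ (IsClosed.inter ?_ (IsClosed.inter ?_ ?_))) <;>
      exact isClosed_le (by fun_prop) (by fun_prop)
  have hNC : N ⊆ C := by
    rintro ⟨s, y, z⟩ ⟨h1, h2, h3, h4⟩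
    simp only at h1 h2 h3 h4
    exact ⟨QQ_of_near (k := k) (by linarith) (by nlinarith) (by linarith) (by linarith),
      h1.le, h2.le, h3.le, h4.le⟩
  have hCW : C ⊆ W := by
    rintro ⟨s, y, z⟩ ⟨h0, h1, h2, h3, h4⟩
    simp only at h1 h2 h3 h4
    refine ⟨?_, ?_, ?_, ?_⟩ <;> simp only <;> nlinarith
  have hCc : IsClosed (φ '' C) := (hC.image hφ.continuous).isClosed
  have hWo : IsOpen (φ '' W) := hφ.isOpenMap _ hW
  have hAc : IsClosed (φ '' AA m u v t) :=
    ((isCompact_AA m u v t).image hφ.continuous).isClosed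
  have hsub : (φ '' AA m u v t)ᶜ ⊆ φ '' C ∪ (φ '' W)ᶜ := by
    intro x hx
    by_cases hxW : x ∈ φ '' W
    · left
      obtain ⟨⟨s, y, z⟩, ⟨h1, h2, h3, h4⟩, rfl⟩ := hxW
      simp only at h1 h2 h3 h4
      refine ⟨_, hNC ?_, rfl⟩
      by_contra hpN
      refine hx ⟨_, ⟨QQ_of_near (k := k) (by linarith) (by linarith) (by linarith) (by linarith),
        fun j => ?_⟩, rfl⟩
      by_cases hj : j = k
      · subst hj
        by_contra hD
        simp only [DD, not_or, not_and, not_le, hv, zero_mul] at hD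
        obtain ⟨k1, k2, k3, k4, k5⟩ := hD
        refine hpN ⟨?_, k1, k3, k2⟩
        by_contra hs
        simp only [not_lt] at hs
        exact absurd (k5 (by linarith) hs) (not_lt.2 (abs_nonneg _))
      · exact Or.inr (Or.inr (Or.inl (aa_disj hj h3.le)))
    · exact Or.inr hxW
  have hfr : frontier (φ '' AA m u v t) = φ '' AA m u v t ∩ closure ((φ '' AA m u v t)ᶜ) := by
    rw [frontier_eq_closure_inter_closure, hAc.closure_eq]
  have hfsub : frontier (φ '' AA m u v t) ⊆ φ '' C ∪ (φ '' W)ᶜ := by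
    rw [hfr]
    exact inter_subset_right.trans (closure_minimal hsub (hCc.union hWo.isClosed_compl))
  -- a point of the frontier in `C`
  have hp1 : φ ((3 + t k) * aa k, aa k, 0) ∈ frontier (φ '' AA m u v t) := by
    rw [hfr]
    refine ⟨⟨_, bottom_mem m ht k, rfl⟩, ?_⟩
    have hc : Continuous (fun r : ℝ => φ ((r, aa k, 0) : EE m)) :=
      hφ.continuous.comp (by fun_prop)
    have h2 : (3 + t k) * aa k ∈ closure (Ioo (2 * aa k) ((3 + t k) * aa k)) := by
      have hlt : 2 * aa k < (3 + t k) * aa k := by nlinarith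
      rw [closure_Ioo hlt.ne]
      exact ⟨hlt.le, le_rfl⟩
    refine map_mem_closure (f := fun r : ℝ => φ ((r, aa k, 0) : EE m)) hc h2 fun r hr => ?_
    rintro ⟨p, hp, e⟩
    have := hφ.injective e
    subst this
    exact chamber_notMem m k hr.1 hr.2 (by simp [ha]) (by simp [ha]) hp
  have hp1C : φ ((3 + t k) * aa k, aa k, 0) ∈ φ '' C := by
    refine ⟨_, ⟨(bottom_mem m (u := u) (v := v) ht k).1, ?_, le_rfl, ?_, ?_⟩, rfl⟩
    · simp only; nlinarith
    · simp; linarith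
    · simp; linarith
  have hp2 : φ (10, 0, 0) ∈ frontier (φ '' AA m u v t) := by
    rw [hfr]
    refine ⟨⟨_, deep_mem ht ((mem_QQ _).2 (by simp)) (by norm_num), rfl⟩, ?_⟩
    have hc : Continuous (fun r : ℝ => φ ((r, 0, 0) : EE m)) :=
      hφ.continuous.comp (by fun_prop)
    have h2 : (10 : ℝ) ∈ closure (Ioi (10 : ℝ)) := by simp
    refine map_mem_closure (f := fun r : ℝ => φ ((r, 0, 0) : EE m)) hc h2 fun r hr => ?_
    rintro ⟨p, hp, e⟩
    have := hφ.injective e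
    subst this
    have := ((mem_QQ _).1 hp.1).1.2
    exact absurd this (not_le.2 hr)
  have hp2W : φ (10, 0, 0) ∈ (φ '' W)ᶜ := by
    rintro ⟨p, hp, e⟩
    have := hφ.injective e
    subst this
    have := hp.2.1
    norm_num at this
  intro hcon
  have hpc := hcon.isPreconnected
  rw [isPreconnected_closed_iff] at hpc
  obtain ⟨x, -, hx1, hx2⟩ := hpc (φ '' C) ((φ '' W)ᶜ) hCc hWo.isClosed_compl hfsub
    ⟨_, hp1, hp1C⟩ ⟨_, hp2, hp2W⟩
  exact hx2 (image_mono hCW hx1)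

lemma frontier_conn {m : ℕ} {φ : EE m → X} (hφ : IsOpenEmbedding φ) (huc : Unicoherent X)
    {u v t : ℕ → ℝ} (hu : Unit01 u) (hv : Unit01 v)
    (ht : Unit01 t) (hv0 : ∀ k, 0 < v k) : IsConnected (frontier (φ '' AA m u v t)) := by
  have hAc : IsClosed (φ '' AA m u v t) :=
    ((isCompact_AA m u v t).image hφ.continuous).isClosed
  have hcl : IsPreconnected (closure ((φ '' AA m u v t)ᶜ)) :=
    (TT_preconn hφ ht hv0).subset_closure
      (TT_subset_closure hφ u v t) (closure_mono (compl_subset_TT hφ u v t))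
  rw [frontier_eq_closure_inter_closure, hAc.closure_eq]
  refine huc _ _ hAc isClosed_closure ((isConnected_AA m u v t hu hv ht).image _
    hφ.continuous.continuousOn) ⟨⟨φ (0, aa 0, 0), ?_⟩, hcl⟩ ?_
  · refine closure_mono ?_ (top_closure hφ 0)
    rw [compl_AA hφ]
    exact subset_union_left
  · rw [eq_univ_iff_forall]
    intro x
    by_cases hx : x ∈ φ '' AA m u v t
    · exact Or.inl hx
    · exact Or.inr (subset_closure hx)

end transfer

lemma exists_zero_fun (F : Set Iinf) (hF : IsClosed F) :
    ∃ g : Iinf → ℝ, Continuous g ∧ (∀ q, 0 ≤ g q ∧ g q ≤ 1) ∧ ∀ q, g q = 0 ↔ q ∈ F := by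
  letI := TopologicalSpace.metrizableSpaceMetric Iinf
  rcases F.eq_empty_or_nonempty with rfl | hne
  · exact ⟨fun _ => 1, continuous_const, fun q => by norm_num, fun q => by simp⟩
  · refine ⟨fun q => min 1 (infDist q F), by fun_prop, fun q =>
      ⟨le_min zero_le_one infDist_nonneg, min_le_left _ _⟩, fun q => ?_⟩
    rw [hF.mem_iff_infDist_zero hne]
    beta_reduce
    constructor
    · intro h
      rcases min_choice 1 (infDist q F) with h' | h'
      · rw [h'] at h; norm_num at h
      · rw [h'] at h; exact h
    · intro h; rw [h]; simp

/-- Continuity of the model map. -/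
lemma AA_continuous (m : ℕ) (u v t : ℕ → Iinf → ℝ) (hu : ∀ q, Unit01 fun k => u k q)
    (hv : ∀ q, Unit01 fun k => v k q) (ht : ∀ q, Unit01 fun k => t k q)
    (hcu : ∀ k, Continuous (u k)) (hcv : ∀ k, Continuous (v k)) (hct : ∀ k, Continuous (t k))
    (F : Iinf → TopologicalSpace.NonemptyCompacts (EE m))
    (hF : ∀ q, (F q : Set (EE m)) = AA m (fun k => u k q) (fun k => v k q) (fun k => t k q)) :
    Continuous F := by
  rw [continuous_iff_continuousAt]
  intro q
  rw [ContinuousAt, Metric.tendsto_nhds]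
  intro ε hε
  obtain ⟨K, hK⟩ : ∃ K, aa K < ε / 2 := exists_pow_lt_of_lt_one (by positivity) (by norm_num)
  have hev : ∀ (w : ℕ → Iinf → ℝ), (∀ k, Continuous (w k)) → ∀ᶠ q' in 𝓝 q,
      ∀ k ∈ Finset.range K, |w k q' - w k q| < ε / 2 := by
    intro w hw
    rw [Filter.eventually_all_finset]
    intro k _
    exact (Metric.tendsto_nhds.1 (hw k).continuousAt) (ε / 2) (by positivity)
  have hbd : ∀ (w : ℕ → Iinf → ℝ), (∀ q, Unit01 fun k => w k q) → ∀ q',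
      (∀ k ∈ Finset.range K, |w k q' - w k q| < ε / 2) →
      ∀ k, aa k * |w k q' - w k q| ≤ ε / 2 := by
    intro w hw q' h k
    have ha := aa_pos k
    have ha1 := aa_le_one k
    have hn := abs_nonneg (w k q' - w k q)
    by_cases hk : k < K
    · have := h k (Finset.mem_range.2 hk)
      nlinarith
    · have h1 : aa k ≤ aa K := pow_le_pow_of_le_one (by norm_num) (by norm_num) (not_lt.1 hk)
      have h2 : |w k q' - w k q| ≤ 1 := by
        have h3 := hw q' k
        have h4 := hw q k
        simp only at h3 h4
        rw [abs_le]; constructor <;> linarith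
      nlinarith
  filter_upwards [hev u hcu, hev v hcv, hev t hct] with q' h1 h2 h3
  have b1 := hbd u hu q' h1
  have b2 := hbd v hv q' h2
  have b3 := hbd t ht q' h3
  rw [NonemptyCompacts.dist_eq, hF, hF]
  refine lt_of_le_of_lt (hausdorffDist_le_of_mem_dist (r := ε / 2) (by positivity) ?_ ?_)
    (by linarith)
  · intro x hx
    refine AA_close (hu q) (hv q) (ht q) (by positivity) (fun k => ?_) hx
    simp only [abs_sub_comm (u k q), abs_sub_comm (v k q), abs_sub_comm (t k q)]
    exact ⟨b1 k, b2 k, b3 k⟩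
  · intro x hx
    exact AA_close (hu q') (hv q') (ht q') (by positivity) (fun k => ⟨b1 k, b2 k, b3 k⟩) hx

/-- If `X` is a nondegenerate unicoherent Peano continuum without free
arcs containing an open subset homeomorphic to `ℝⁿ`, `2 ≤ n < ∞`, then
`S(X) ∩ CB(X)` is `D_2(F_σ)`-universal in `C(X)`. -/
theorem SepSet_inter_CBSet_D2Fsigma_universal (X : Type*) [MetricSpace X] [CompactSpace X]
    [ConnectedSpace X] [Nontrivial X] [LocallyConnectedSpace X]
    (huc : Unicoherent X) (hfa : ∀ A : Set X, ¬ IsFreeArc A)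
    (n : ℕ) (hn : 2 ≤ n)
    (hU : ∃ U : Set X, IsOpen U ∧ Nonempty (U ≃ₜ (Fin n → ℝ))) :
    ∀ M : Set Iinf, IsD2Fsigma M →
      ∃ f : Iinf → ↥(CSet X), IsEmbedding f ∧
        f ⁻¹' {A : ↥(CSet X) | (A : Hyper X) ∈ SepSet X ∩ CBSet X} = M := by
  rintro M ⟨P, R, ⟨PF, hPF, rfl⟩, ⟨RF, hRF, rfl⟩, rfl⟩
  obtain ⟨U, hUo, ⟨e⟩⟩ := hU
  obtain ⟨m, rfl⟩ : ∃ m, n = m + 2 := ⟨n - 2, by omega⟩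
  -- the chart
  obtain ⟨φ, hφ⟩ : ∃ φ : EE m → X, IsOpenEmbedding φ := by
    have hfr : Module.finrank ℝ (EE m) = Module.finrank ℝ (Fin (m + 2) → ℝ) := by
      simp; ring
    let L := (ContinuousLinearEquiv.ofFinrankEq hfr).toHomeomorph
    exact ⟨fun x => (e.symm (L x) : X),
      hUo.isOpenEmbedding_subtypeVal.comp (e.symm.isOpenEmbedding.comp L.isOpenEmbedding)⟩
  choose u hcu hu hu0 using fun k => exists_zero_fun (PF k) (hPF k)
  choose v hcv hv hv0 using fun k => exists_zero_fun (RF k) (hRF k)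
  let t : ℕ → Iinf → ℝ := fun k q => (q k : ℝ)
  have hct : ∀ k, Continuous (t k) := fun k => by fun_prop
  have hu' : ∀ q, Unit01 fun k => u k q := fun q k => hu k q
  have hv' : ∀ q, Unit01 fun k => v k q := fun q k => hv k q
  have ht' : ∀ q, Unit01 fun k => t k q := fun q k => (q k).2
  let F : Iinf → TopologicalSpace.NonemptyCompacts (EE m) := fun q =>
    ⟨⟨AA m (fun k => u k q) (fun k => v k q) (fun k => t k q), isCompact_AA _ _ _ _⟩,
      (isConnected_AA m _ _ _ (hu' q) (hv' q) (ht' q)).nonempty⟩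
  have hF : Continuous F :=
    AA_continuous m u v t hu' hv' ht' hcu hcv hct F (fun q => rfl)
  let f : Iinf → ↥(CSet X) := fun q => ⟨(F q).map φ hφ.continuous,
    (isConnected_AA m _ _ _ (hu' q) (hv' q) (ht' q)).image _ hφ.continuous.continuousOn⟩
  have hfc : Continuous f :=
    Continuous.subtype_mk (hφ.continuous.nonemptyCompacts_map.comp hF) _
  have hfco : ∀ q, ((f q : Hyper X) : Set X) =
      φ '' AA m (fun k => u k q) (fun k => v k q) (fun k => t k q) := fun q => rfl
  have hfi : Function.Injective f := by
    intro q q' h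
    have h1 : φ '' AA m (fun k => u k q) (fun k => v k q) (fun k => t k q) =
        φ '' AA m (fun k => u k q') (fun k => v k q') (fun k => t k q') := by
      rw [← hfco, ← hfco, h]
    have h2 := AA_inj m (ht' q) (ht' q') (hφ.injective.image_injective h1)
    funext k
    exact Subtype.ext (congrFun h2 k)
  refine ⟨f, (hfc.isClosedEmbedding hfi).isEmbedding, ?_⟩
  ext q
  simp only [mem_preimage, mem_setOf_eq, SepSet, CBSet, mem_inter_iff, hfco, mem_diff, mem_iUnion]
  constructor
  · rintro ⟨hsep, -, -, hfr⟩
    have hR : ¬ ∃ k, q ∈ RF k := by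
      rintro ⟨k, hk⟩
      exact frontier_disc hφ (ht' q) (k := k) ((hv0 k q).2 hk) hfr
    refine ⟨?_, hR⟩
    by_contra! hP
    apply hsep
    have hup : ∀ k, 0 < u k q := fun k =>
      lt_of_le_of_ne (hu k q).1 fun h => hP k ((hu0 k q).1 h.symm)
    have hvp : ∀ k, 0 < v k q := fun k =>
      lt_of_le_of_ne (hv k q).1 fun h => hR ⟨k, (hv0 k q).1 h.symm⟩
    rw [← TT_eq hφ (ht' q) hup]
    exact TT_preconn hφ (ht' q) hvp
  · rintro ⟨⟨k, hk⟩, hR⟩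
    have hvp : ∀ k, 0 < v k q := fun k =>
      lt_of_le_of_ne (hv k q).1 fun h => hR ⟨k, (hv0 k q).1 h.symm⟩
    have hsep := separates (X := X) hφ (v := fun k => v k q) (ht' q) (k := k)
      (u := fun k => u k q) ((hu0 k q).2 hk)
    refine ⟨hsep, (isConnected_AA m _ _ _ (hu' q) (hv' q) (ht' q)).image _
      hφ.continuous.continuousOn, ?_, frontier_conn hφ huc (hu' q) (hv' q) (ht' q) hvp⟩
    intro h
    apply hsep
    rw [h, compl_univ]
    exact isPreconnected_empty
end
end

section
/- If X is a nondegenerate continuum containing the open cube (−3,3)^n as an open subset, where 2 ≤ n < ∞, then there exists an embedding Φ : I^∞ × I^∞ → C(X) such that Φ((q_k),(t_k)) ∈ S(X) ∩ CB(X) if and only if ((q_k),(t_k)) ∈ ∂(I^∞) × (0,1)^∞. -/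
open Set Topology Metric

noncomputable section

/-! ### The region of revolution with profile `ρ` -/

section Geometry

variable {V : Type*} [NormedAddCommGroup V] [NormedSpace ℝ V]

/-- The open body of revolution with profile `ρ`. -/
def Body (V : Type*) [NormedAddCommGroup V] (ρ : ℝ → ℝ) : Set (ℝ × V) :=
  {x | ‖x.2‖ < ρ x.1}

/-- The positivity set of the profile. -/
def Pos (ρ : ℝ → ℝ) : Set ℝ := {y | 0 < ρ y}

lemma body_eq_image (ρ : ℝ → ℝ) :
    Body V ρ = (fun x : ℝ × V => (x.1, ρ x.1 • x.2)) '' (Pos ρ ×ˢ ball (0 : V) 1) := by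
  ext ⟨y, z⟩
  simp only [Body, Pos, mem_ofPred_eq, mem_image, mem_prod, mem_ball_zero_iff, Prod.exists,
    Prod.mk.injEq]
  constructor
  · intro h
    have hp : 0 < ρ y := lt_of_le_of_lt (norm_nonneg _) h
    refine ⟨y, (ρ y)⁻¹ • z, ⟨hp, ?_⟩, rfl, ?_⟩
    · rw [norm_smul, norm_inv, Real.norm_of_nonneg hp.le, inv_mul_lt_iff₀ hp, mul_one]
      exact h
    · rw [smul_smul, mul_inv_cancel₀ hp.ne', one_smul]
  · rintro ⟨a, b, ⟨ha, hb⟩, rfl, rfl⟩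
    rw [norm_smul, Real.norm_of_nonneg ha.le]
    nlinarith

lemma cont_phi {ρ : ℝ → ℝ} (hc : Continuous ρ) :
    Continuous (fun x : ℝ × V => (x.1, ρ x.1 • x.2)) := by
  fun_prop

lemma body_isOpen {ρ : ℝ → ℝ} (hc : Continuous ρ) : IsOpen (Body V ρ) :=
  isOpen_lt (by fun_prop) (by fun_prop)

lemma fst_body (ρ : ℝ → ℝ) : Prod.fst '' (Body V ρ) = Pos ρ := by
  ext y
  constructor
  · rintro ⟨⟨y, z⟩, h, rfl⟩
    exact lt_of_le_of_lt (norm_nonneg _) h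
  · intro h
    exact ⟨(y, 0), by simpa [Body, Pos] using h, rfl⟩

lemma body_preconnected_iff {ρ : ℝ → ℝ} (hc : Continuous ρ) :
    IsPreconnected (Body V ρ) ↔ IsPreconnected (Pos ρ) := by
  constructor
  · intro h
    rw [← fst_body (V := V)]
    exact h.image _ continuous_fst.continuousOn
  · intro h
    rw [body_eq_image ρ]
    exact (h.prod (convex_ball (0 : V) 1).isPreconnected).image _ (cont_phi hc).continuousOn

lemma closure_body {ρ : ℝ → ℝ} (hc : Continuous ρ) (h0 : ∀ y, 0 ≤ ρ y) :
    closure (Body V ρ) = {x | ‖x.2‖ ≤ ρ x.1 ∧ x.1 ∈ closure (Pos ρ)} := by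
  apply Subset.antisymm
  · apply closure_minimal
    · intro x hx
      exact ⟨le_of_lt hx, subset_closure (lt_of_le_of_lt (norm_nonneg _) hx)⟩
    · have h1 : IsClosed {x : ℝ × V | ‖x.2‖ ≤ ρ x.1} := isClosed_le (by fun_prop) (by fun_prop)
      exact h1.inter (isClosed_closure.preimage continuous_fst)
  · rintro ⟨y, z⟩ ⟨hz, hy⟩
    simp only at hz hy
    obtain ⟨v, hv, rfl⟩ : ∃ v : V, ‖v‖ ≤ 1 ∧ ρ y • v = z := by
      rcases (h0 y).eq_or_lt with h | h
      · refine ⟨0, by simp, ?_⟩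
        rw [← h] at hz
        simp [norm_le_zero_iff.mp hz]
      · refine ⟨(ρ y)⁻¹ • z, ?_, ?_⟩
        · rw [norm_smul, norm_inv, Real.norm_of_nonneg h.le, inv_mul_le_iff₀ h, mul_one]
          exact hz
        · rw [smul_smul, mul_inv_cancel₀ h.ne', one_smul]
    have hm : (y, v) ∈ closure (Pos ρ ×ˢ ball (0 : V) 1) := by
      rw [closure_prod_eq, closure_ball (0 : V) one_ne_zero]
      exact ⟨hy, by simpa using hv⟩
    rw [body_eq_image ρ]
    exact image_closure_subset_closure_image (cont_phi hc) ⟨_, hm, rfl⟩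

lemma frontier_body {ρ : ℝ → ℝ} (hc : Continuous ρ) (h0 : ∀ y, 0 ≤ ρ y) :
    frontier (Body V ρ) = {x | ‖x.2‖ = ρ x.1 ∧ x.1 ∈ closure (Pos ρ)} := by
  rw [(body_isOpen hc).frontier_eq, closure_body hc h0]
  ext x
  simp only [Body, mem_sdiff, mem_ofPred_eq, not_lt]
  constructor
  · rintro ⟨⟨a, b⟩, c⟩
    exact ⟨le_antisymm a c, b⟩
  · rintro ⟨a, b⟩
    exact ⟨⟨a.le, b⟩, a.ge⟩

lemma exists_dir [Nontrivial V] (z : V) : ∃ v : V, ‖v‖ = 1 ∧ z = ‖z‖ • v := by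
  by_cases h : z = 0
  · obtain ⟨v, hv⟩ := exists_norm_eq V (c := 1) zero_le_one
    exact ⟨v, hv, by simp [h]⟩
  · refine ⟨‖z‖⁻¹ • z, ?_, ?_⟩
    · rw [norm_smul, norm_inv, norm_norm, inv_mul_cancel₀ (norm_ne_zero_iff.mpr h)]
    · rw [smul_smul, mul_inv_cancel₀ (norm_ne_zero_iff.mpr h), one_smul]

lemma frontier_body_preconnected_iff [Nontrivial V] {ρ : ℝ → ℝ} (hc : Continuous ρ)
    (h0 : ∀ y, 0 ≤ ρ y) (hs : ∀ y, 0 < ρ y → y ∈ Ioo (0 : ℝ) 1) (hne : (Pos ρ).Nonempty) :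
    IsPreconnected (frontier (Body V ρ)) ↔ IsPreconnected (closure (Pos ρ)) := by
  rw [frontier_body hc h0]
  constructor
  · intro h
    convert h.image Prod.fst continuous_fst.continuousOn using 1
    ext y
    constructor
    · intro hy
      obtain ⟨v, hv⟩ := exists_norm_eq V (c := ρ y) (h0 y)
      exact ⟨(y, v), ⟨hv, hy⟩, rfl⟩
    · rintro ⟨x, hx, rfl⟩
      exact hx.2
  · intro h
    obtain ⟨y0, hy0, hy0'⟩ : ∃ y0 ∈ closure (Pos ρ), ρ y0 = 0 := by
      by_contra! hcon
      have hcl : IsClosed (Pos ρ) := by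
        apply isClosed_of_closure_subset
        intro y hy
        exact lt_of_le_of_ne (h0 y) (hcon y hy).symm
      have hop : IsOpen (Pos ρ) := isOpen_lt continuous_const hc
      have := IsClopen.eq_univ ⟨hcl, hop⟩ hne
      have h2 : (2 : ℝ) ∈ Pos ρ := this ▸ mem_univ _
      have := (hs 2 h2).2
      norm_num at this
    have : {x : ℝ × V | ‖x.2‖ = ρ x.1 ∧ x.1 ∈ closure (Pos ρ)} =
        ⋃ v : sphere (0 : V) 1, (fun y => (y, ρ y • (v : V))) '' closure (Pos ρ) := by
      ext ⟨y, z⟩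
      simp only [mem_ofPred_eq, mem_iUnion, mem_image, Prod.mk.injEq]
      constructor
      · rintro ⟨hz, hy⟩
        obtain ⟨v, hv, hv'⟩ := exists_dir z
        exact ⟨⟨v, by simpa using hv⟩, y, hy, rfl, by rw [← hz, ← hv']⟩
      · rintro ⟨⟨v, hv⟩, y, hy, rfl, rfl⟩
        have hv : ‖v‖ = 1 := by simpa using hv
        refine ⟨?_, hy⟩
        rw [norm_smul, hv, mul_one, Real.norm_of_nonneg (h0 _)]
    rw [this]
    apply isPreconnected_iUnion
    · refine ⟨(y0, 0), mem_iInter.mpr fun v => ?_⟩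
      exact ⟨y0, hy0, by simp [hy0']⟩
    · intro v
      exact h.image _ (by fun_prop)

lemma compl_body_preconnected [Nontrivial V] {ρ : ℝ → ℝ} (hc : Continuous ρ)
    (h0 : ∀ y, 0 ≤ ρ y) (hs : ∀ y, 0 < ρ y → y ∈ Ioo (0 : ℝ) 1) :
    IsPreconnected (Body V ρ)ᶜ := by
  have : (Body V ρ)ᶜ = ⋃ v : sphere (0 : V) 1,
      (fun x : ℝ × ℝ => (x.1, (ρ x.1 + x.2) • (v : V))) '' (univ ×ˢ Ici 0) := by
    ext ⟨y, z⟩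
    simp only [Body, mem_compl_iff, mem_ofPred_eq, not_lt, mem_iUnion, mem_image, Prod.mk.injEq]
    constructor
    · intro h
      obtain ⟨v, hv, hv'⟩ := exists_dir z
      exact ⟨⟨v, by simpa using hv⟩, (y, ‖z‖ - ρ y), ⟨mem_univ _, by simpa using h⟩, rfl,
        by simpa using hv'.symm⟩
    · rintro ⟨⟨v, hv⟩, ⟨y, r⟩, ⟨-, hr⟩, rfl, rfl⟩
      have hv : ‖v‖ = 1 := by simpa using hv
      have hr : 0 ≤ r := hr
      have := h0 y
      simp only
      rw [norm_smul, hv, mul_one, Real.norm_of_nonneg (by positivity)]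
      linarith
  rw [this]
  apply isPreconnected_iUnion
  · refine ⟨((2 : ℝ), (0 : V)), mem_iInter.mpr fun v => ?_⟩
    refine ⟨(2, 0), ⟨mem_univ _, by simp⟩, ?_⟩
    have : ρ 2 = 0 := by
      by_contra h
      have := (hs 2 (lt_of_le_of_ne (h0 2) (Ne.symm h))).2
      norm_num at this
    simp [this]
  · intro v
    exact (isPreconnected_univ.prod isPreconnected_Ici).image _ (by fun_prop)

lemma closure_body_compact [ProperSpace V] {ρ : ℝ → ℝ} (hc : Continuous ρ) (h0 : ∀ y, 0 ≤ ρ y)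
    (hs : ∀ y, 0 < ρ y → y ∈ Ioo (0 : ℝ) 1) : IsCompact (closure (Body V ρ)) := by
  rw [closure_body hc h0, ← closure_body hc h0]
  have h : Body V ρ ⊆ (fun x : ℝ × V => (x.1, ρ x.1 • x.2)) '' (Icc 0 1 ×ˢ closedBall (0 : V) 1) := by
    rw [body_eq_image ρ]
    apply image_mono
    apply prod_mono _ ball_subset_closedBall
    intro y hy
    exact Ioo_subset_Icc_self (hs y hy)
  exact ((isCompact_Icc.prod (isCompact_closedBall 0 1)).image (cont_phi hc)).closure_of_subset h

/-- Removing a relatively compact piece with connected complement in the chart keeps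
the space connected. -/
lemma compl_image_preconnected {X E : Type*} [TopologicalSpace X] [T2Space X] [ConnectedSpace X]
    [TopologicalSpace E] {i : E → X} (hi : IsOpenEmbedding i) {S : Set E}
    (hS : IsCompact (closure S)) (hne : Sᶜ.Nonempty) (hc : IsPreconnected Sᶜ) :
    IsPreconnected (i '' S)ᶜ := by
  classical
  apply isPreconnected_of_forall_constant
  intro f hf x hx y hy
  obtain ⟨e0, he0⟩ := hne
  have hmem : ∀ e, e ∈ Sᶜ → i e ∈ (i '' S)ᶜ := by
    rintro e he ⟨e', he', h⟩
    exact he (hi.injective h ▸ he')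
  have hconst : ∀ e ∈ Sᶜ, f (i e) = f (i e0) := by
    intro e he
    have := hc.image i hi.continuous.continuousOn
    exact this.constant (hf.mono (by rintro _ ⟨e, he, rfl⟩; exact hmem e he))
      ⟨e, he, rfl⟩ ⟨e0, he0, rfl⟩
  let g : X → Bool := fun x => if x ∈ i '' S then f (i e0) else f x
  have hg1 : ∀ e, g (i e) = f (i e0) := by
    intro e
    by_cases h : e ∈ S
    · exact if_pos ⟨e, h, rfl⟩
    · have : i e ∉ i '' S := hmem e h
      simp only [g, if_neg this]
      exact hconst e h
  have hgc : Continuous g := by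
    rw [continuous_iff_continuousAt]
    intro x
    by_cases hx : x ∈ range i
    · have : g =ᶠ[𝓝 x] fun _ => f (i e0) := by
        filter_upwards [hi.isOpen_range.mem_nhds hx]
        rintro _ ⟨e, rfl⟩
        exact hg1 e
      exact continuousAt_const.congr this.symm
    · have hK : IsClosed (i '' closure S) := (hS.image hi.continuous).isClosed
      have hxK : x ∈ (i '' closure S)ᶜ := fun ⟨e, _, h⟩ => hx ⟨e, h⟩
      have hsub : (i '' closure S)ᶜ ⊆ (i '' S)ᶜ := compl_subset_compl.mpr (image_mono subset_closure)
      have hn := hK.isOpen_compl.mem_nhds hxK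
      have : g =ᶠ[𝓝 x] f := by
        filter_upwards [hn] with w hw
        exact if_neg (hsub hw)
      exact ((hf.mono hsub).continuousAt hn).congr this.symm
  have := (isPreconnected_univ (α := X)).constant hgc.continuousOn (mem_univ x) (mem_univ y)
  simp only [g] at this
  rwa [if_neg hx, if_neg hy] at this

lemma frontier_image_open {X E : Type*} [TopologicalSpace X] [T2Space X]
    [TopologicalSpace E] {i : E → X} (hi : IsOpenEmbedding i) {S : Set E} (hSo : IsOpen S)
    (hS : IsCompact (closure S)) : frontier (i '' S) = i '' frontier S := by
  have hcl : closure (i '' S) = i '' closure S := by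
    apply Subset.antisymm
    · exact closure_minimal (image_mono subset_closure) (hS.image hi.continuous).isClosed
    · exact image_closure_subset_closure_image hi.continuous
  rw [(hi.isOpenMap _ hSo).frontier_eq, hSo.frontier_eq, hcl, image_sdiff hi.injective]

end Geometry

/-! ### The profile functions -/

section Profile

/-- A tent around `1 / (j + 2)`. -/
def tent (j : ℕ) (y : ℝ) : ℝ := max 0 (y - |1 - ((j : ℝ) + 2) * y|)

lemma tent_nonneg (j : ℕ) (y : ℝ) : 0 ≤ tent j y := le_max_left _ _

lemma tent_cont (j : ℕ) : Continuous (tent j) := by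
  unfold tent
  fun_prop

lemma tent_pos_iff (j : ℕ) (y : ℝ) :
    0 < tent j y ↔ 1 < ((j : ℝ) + 3) * y ∧ ((j : ℝ) + 1) * y < 1 := by
  unfold tent
  rw [lt_max_iff]
  simp only [lt_self_iff_false, false_or, sub_pos, abs_lt]
  constructor
  · rintro ⟨a, b⟩
    constructor <;> linarith
  · rintro ⟨a, b⟩
    constructor <;> linarith

lemma tent_pos_mem {j : ℕ} {y : ℝ} (h : 0 < tent j y) : y ∈ Ioo (0 : ℝ) 1 := by
  rw [tent_pos_iff] at h
  have hj : (0 : ℝ) ≤ j := Nat.cast_nonneg j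
  have hy : 0 < y := by
    by_contra hy
    nlinarith
  refine ⟨hy, ?_⟩
  nlinarith

lemma tent_le_one (j : ℕ) (y : ℝ) : tent j y ≤ 1 := by
  by_cases h : 0 < tent j y
  · have h1 := (tent_pos_mem h).2
    unfold tent
    apply max_le zero_le_one
    have := abs_nonneg (1 - ((j : ℝ) + 2) * y)
    linarith
  · linarith

lemma tent_node (j k : ℕ) : tent j (1 / ((k : ℝ) + 2)) = if j = k then 1 / ((k : ℝ) + 2) else 0 := by
  have hk : (0 : ℝ) < (k : ℝ) + 2 := by positivity
  split_ifs with h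
  · subst h
    unfold tent
    rw [mul_one_div_cancel hk.ne']
    simp only [sub_self, abs_zero, sub_zero]
    exact max_eq_right (by positivity)
  · by_contra hne
    have hp := lt_of_le_of_ne (tent_nonneg _ _) (Ne.symm hne)
    rw [tent_pos_iff, mul_one_div, mul_one_div, lt_div_iff₀ hk, div_lt_iff₀ hk] at hp
    obtain ⟨a, b⟩ := hp
    have a' : (k : ℝ) < j + 1 := by linarith
    have b' : (j : ℝ) < k + 1 := by linarith
    have a2 : k < j + 1 := by exact_mod_cast a'
    have b2 : j < k + 1 := by exact_mod_cast b'
    omega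

/-- The profile with heights `c`. -/
def prof (c : ℕ → ℝ) (y : ℝ) : ℝ := ∑' j, (1 / 2 : ℝ) ^ j * c j * tent j y

variable {c : ℕ → ℝ}

lemma term_nonneg (hc0 : ∀ j, 0 ≤ c j) (y : ℝ) (j : ℕ) : 0 ≤ (1 / 2 : ℝ) ^ j * c j * tent j y :=
  mul_nonneg (mul_nonneg (by positivity) (hc0 j)) (tent_nonneg _ _)

lemma term_le (hc0 : ∀ j, 0 ≤ c j) (hc2 : ∀ j, c j ≤ 2) (y : ℝ) (j : ℕ) :
    (1 / 2 : ℝ) ^ j * c j * tent j y ≤ (1 / 2 : ℝ) ^ j * 2 := by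
  have h1 := tent_le_one j y
  have h2 := tent_nonneg j y
  have h3 := hc0 j
  have h4 := hc2 j
  rw [mul_assoc]
  apply mul_le_mul_of_nonneg_left _ (by positivity)
  nlinarith

lemma summable_bd : Summable (fun j : ℕ => (1 / 2 : ℝ) ^ j * 2) :=
  (summable_geometric_of_lt_one (by norm_num) (by norm_num)).mul_right 2

lemma term_summable (hc0 : ∀ j, 0 ≤ c j) (hc2 : ∀ j, c j ≤ 2) (y : ℝ) :
    Summable (fun j : ℕ => (1 / 2 : ℝ) ^ j * c j * tent j y) :=
  Summable.of_nonneg_of_le (term_nonneg hc0 y) (term_le hc0 hc2 y) summable_bd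

lemma prof_nonneg (hc0 : ∀ j, 0 ≤ c j) (y : ℝ) : 0 ≤ prof c y :=
  tsum_nonneg (term_nonneg hc0 y)

lemma prof_pos_iff (hc0 : ∀ j, 0 ≤ c j) (hc2 : ∀ j, c j ≤ 2) (y : ℝ) :
    0 < prof c y ↔ ∃ j, 0 < c j ∧ 0 < tent j y := by
  constructor
  · intro h
    by_contra! hcon
    have : prof c y = 0 := by
      unfold prof
      convert tsum_zero with j
      rcases (hc0 j).eq_or_lt with h | h
      · simp [← h]
      · have := le_antisymm (hcon j h) (tent_nonneg _ _)
        simp [this]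
    linarith
  · rintro ⟨j, h1, h2⟩
    exact (term_summable hc0 hc2 y).tsum_pos (term_nonneg hc0 y) j (by positivity)

lemma prof_node (k : ℕ) :
    prof c (1 / ((k : ℝ) + 2)) = (1 / 2 : ℝ) ^ k * c k * (1 / ((k : ℝ) + 2)) := by
  unfold prof
  rw [tsum_eq_single k]
  · rw [tent_node, if_pos rfl]
  · intro j hj
    rw [tent_node, if_neg hj, mul_zero]

lemma prof_supp (hc0 : ∀ j, 0 ≤ c j) (hc2 : ∀ j, c j ≤ 2) (y : ℝ) (h : 0 < prof c y) :
    y ∈ Ioo (0 : ℝ) 1 := by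
  obtain ⟨j, _, hj⟩ := (prof_pos_iff hc0 hc2 y).1 h
  exact tent_pos_mem hj

lemma prof_cont {T : Type*} [TopologicalSpace T] {c : T → ℕ → ℝ} (hc0 : ∀ p j, 0 ≤ c p j)
    (hc2 : ∀ p j, c p j ≤ 2) (hc : ∀ j, Continuous fun p => c p j) :
    Continuous fun x : T × ℝ => prof (c x.1) x.2 := by
  unfold prof
  apply continuous_tsum (u := fun j : ℕ => (1 / 2 : ℝ) ^ j * 2) _ summable_bd
  · intro j x
    rw [Real.norm_of_nonneg (term_nonneg (hc0 x.1) _ _)]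
    exact term_le (hc0 _) (hc2 _) _ _
  · intro j
    have h1 := hc j
    have h2 := tent_cont j
    fun_prop

lemma node_mem_pos (hc0 : ∀ j, 0 ≤ c j) (hc2 : ∀ j, c j ≤ 2) (k : ℕ) :
    1 / ((k : ℝ) + 2) ∈ Pos (prof c) ↔ 0 < c k := by
  change 0 < prof c _ ↔ _
  rw [prof_pos_iff hc0 hc2]
  constructor
  · rintro ⟨j, hj, hj'⟩
    rw [tent_node] at hj'
    split_ifs at hj' with h
    · exact h ▸ hj
    · exact absurd hj' (lt_irrefl _)
  · intro h
    refine ⟨k, h, ?_⟩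
    rw [tent_node, if_pos rfl]
    positivity

/-- Every point of `(0,1)` lies between two consecutive nodes. -/
lemma exists_tent {y : ℝ} (hy : y ∈ Ioo (0 : ℝ) 1) :
    ∃ j : ℕ, 1 ≤ ((j : ℝ) + 2) * y ∧ ((j : ℝ) + 1) * y < 1 := by
  obtain ⟨h0, h1⟩ := hy
  have hs : 1 < 1 / y := by rwa [lt_div_iff₀ h0, one_mul]
  have hc1 : 1 < ⌈1 / y⌉₊ := by
    rw [Nat.lt_ceil]
    exact_mod_cast hs
  obtain ⟨j, hj⟩ : ∃ j, ⌈1 / y⌉₊ = j + 2 := ⟨⌈1 / y⌉₊ - 2, by omega⟩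
  refine ⟨j, ?_, ?_⟩
  · have := Nat.le_ceil (1 / y)
    rw [hj, div_le_iff₀ h0] at this
    push_cast at this
    exact this
  · have := Nat.ceil_lt_add_one (a := 1 / y) (by positivity)
    rw [hj] at this
    push_cast at this
    have h2 : (j : ℝ) + 1 < 1 / y := by linarith
    rwa [lt_div_iff₀ h0] at h2

lemma pos_preconnected (hc0 : ∀ j, 0 ≤ c j) (hc2 : ∀ j, c j ≤ 2) (hp : ∀ j, 0 < c j) :
    IsPreconnected (Pos (prof c)) := by
  have : Pos (prof c) = Ioo 0 1 := by
    apply Subset.antisymm (fun y hy => prof_supp hc0 hc2 y hy)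
    intro y hy
    obtain ⟨j, h1, h2⟩ := exists_tent hy
    exact (prof_pos_iff hc0 hc2 y).2 ⟨j, hp j, (tent_pos_iff j y).2 ⟨by linarith [hy.1], h2⟩⟩
  rw [this]
  exact isPreconnected_Ioo

lemma closure_pos_preconnected (hc0 : ∀ j, 0 ≤ c j) (hc2 : ∀ j, c j ≤ 2) (hp0 : 0 < c 0)
    (hp : ∀ j, 0 < c j ∨ 0 < c (j + 1)) :
    IsPreconnected (closure (Pos (prof c))) := by
  have hcount : (range fun k : ℕ => 1 / ((k : ℝ) + 2)).Countable := countable_range _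
  have hd := (hcount.dense_compl ℝ).open_subset_closure_inter (isOpen_Ioo (a := (0 : ℝ)) (b := 1))
  have hsub : Ioo (0 : ℝ) 1 ∩ (range fun k : ℕ => 1 / ((k : ℝ) + 2))ᶜ ⊆ Pos (prof c) := by
    rintro y ⟨hy, hy'⟩
    obtain ⟨j, h1, h2⟩ := exists_tent hy
    have h3 : 1 < ((j : ℝ) + 2) * y := by
      apply lt_of_le_of_ne h1
      intro h
      apply hy'
      refine ⟨j, ?_⟩
      have : (0 : ℝ) < (j : ℝ) + 2 := by positivity
      simp only
      rw [div_eq_iff this.ne']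
      linarith
    apply (prof_pos_iff hc0 hc2 y).2
    have hj : 0 < c j → ∃ j, 0 < c j ∧ 0 < tent j y := fun h =>
      ⟨j, h, (tent_pos_iff j y).2 ⟨by linarith [hy.1], h2⟩⟩
    rcases j with _ | j
    · exact hj hp0
    · rcases hp j with h | h
      · refine ⟨j, h, (tent_pos_iff j y).2 ?_⟩
        push_cast at h2 h3
        constructor <;> nlinarith [hy.1]
      · exact hj h
  have : closure (Pos (prof c)) = closure (Ioo 0 1) := by
    apply Subset.antisymm
    · exact closure_mono fun y hy => prof_supp hc0 hc2 y hy
    · exact closure_minimal (hd.trans (closure_mono hsub)) isClosed_closure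
  rw [this]
  exact isPreconnected_Ioo.closure

lemma node_le {a b : ℕ} (h : a ≤ b) : 1 / ((b : ℝ) + 2) ≤ 1 / ((a : ℝ) + 2) := by
  have : (a : ℝ) ≤ b := by exact_mod_cast h
  apply one_div_le_one_div_of_le (by positivity)
  linarith

lemma pos_not_preconnected (hc0 : ∀ j, 0 ≤ c j) (hc2 : ∀ j, c j ≤ 2) {a b j : ℕ} (ha : 0 < c a)
    (hb : 0 < c b) (haj : a ≤ j) (hjb : j ≤ b) (hj : c j = 0) :
    ¬ IsPreconnected (Pos (prof c)) := by
  intro h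
  have := h.Icc_subset ((node_mem_pos hc0 hc2 b).2 hb) ((node_mem_pos hc0 hc2 a).2 ha)
    ⟨node_le hjb, node_le haj⟩
  rw [node_mem_pos hc0 hc2] at this
  linarith

lemma closure_pos_not_preconnected (hc0 : ∀ j, 0 ≤ c j) (hc2 : ∀ j, c j ≤ 2) {a b j : ℕ}
    (ha : 0 < c a) (hb : 0 < c b) (haj : a ≤ j) (hjb : j + 1 ≤ b) (hj : c j = 0)
    (hj' : c (j + 1) = 0) : ¬ IsPreconnected (closure (Pos (prof c))) := by
  intro h
  have hlt : 1 / (((j + 1 : ℕ) : ℝ) + 2) < 1 / ((j : ℝ) + 2) := by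
    apply one_div_lt_one_div_of_lt (by positivity)
    push_cast
    linarith
  obtain ⟨y, hy1, hy2⟩ := exists_between hlt
  have hy : y ∈ closure (Pos (prof c)) :=
    h.Icc_subset (subset_closure ((node_mem_pos hc0 hc2 b).2 hb))
      (subset_closure ((node_mem_pos hc0 hc2 a).2 ha))
      ⟨(node_le hjb).trans hy1.le, hy2.le.trans (node_le haj)⟩
  obtain ⟨w, ⟨hw1, hw2⟩, hw⟩ := mem_closure_iff.1 hy _ isOpen_Ioo ⟨hy1, hy2⟩
  obtain ⟨i, hi, hi'⟩ := (prof_pos_iff hc0 hc2 w).1 hw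
  have hw0 := (tent_pos_mem hi').1
  rw [tent_pos_iff] at hi'
  obtain ⟨h1, h2⟩ := hi'
  rw [div_lt_iff₀ (by positivity)] at hw1
  rw [lt_div_iff₀ (by positivity)] at hw2
  push_cast at hw1
  have e1 : (j : ℝ) + 2 < i + 3 := by
    by_contra! hcon
    nlinarith
  have e2 : (i : ℝ) + 1 < j + 3 := by
    by_contra! hcon
    nlinarith
  have e1' : j + 2 < i + 3 := by exact_mod_cast e1
  have e2' : i + 1 < j + 3 := by exact_mod_cast e2
  have : i = j ∨ i = j + 1 := by omega
  rcases this with rfl | rfl <;> linarith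

end Profile

section Heights

/-- The heights attached to a pair of points of the Hilbert cube. -/
def hts (p : Iinf × Iinf) (j : ℕ) : ℝ :=
  if j % 5 = 0 then 1 + (p.1 (j / 5) : ℝ)
  else if j % 5 = 1 then (p.1 (j / 5) : ℝ) * (1 - p.1 (j / 5))
  else if j % 5 = 2 then 1 + (p.2 (j / 5) : ℝ)
  else (p.2 (j / 5) : ℝ) * (1 - p.2 (j / 5))

lemma hts_nonneg (p : Iinf × Iinf) (j : ℕ) : 0 ≤ hts p j := by
  have h1 := (p.1 (j / 5)).2.1
  have h2 := (p.1 (j / 5)).2.2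
  have h3 := (p.2 (j / 5)).2.1
  have h4 := (p.2 (j / 5)).2.2
  unfold hts
  split_ifs <;> nlinarith

lemma hts_le_two (p : Iinf × Iinf) (j : ℕ) : hts p j ≤ 2 := by
  have h1 := (p.1 (j / 5)).2.1
  have h2 := (p.1 (j / 5)).2.2
  have h3 := (p.2 (j / 5)).2.1
  have h4 := (p.2 (j / 5)).2.2
  unfold hts
  split_ifs <;> nlinarith

lemma hts_cont (j : ℕ) : Continuous fun p => hts p j := by
  unfold hts
  split_ifs <;> fun_prop

lemma hts_zero (p : Iinf × Iinf) (k : ℕ) : hts p (5 * k) = 1 + (p.1 k : ℝ) := by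
  have h1 : (5 * k) % 5 = 0 := by omega
  have h2 : (5 * k) / 5 = k := by omega
  simp [hts]

lemma hts_one (p : Iinf × Iinf) (k : ℕ) :
    hts p (5 * k + 1) = (p.1 k : ℝ) * (1 - p.1 k) := by
  have h1 : (5 * k + 1) % 5 = 1 := by omega
  have h2 : (5 * k + 1) / 5 = k := by omega
  simp [hts, h1, h2]

lemma hts_two (p : Iinf × Iinf) (k : ℕ) : hts p (5 * k + 2) = 1 + (p.2 k : ℝ) := by
  have h1 : (5 * k + 2) % 5 = 2 := by omega
  have h2 : (5 * k + 2) / 5 = k := by omega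
  simp [hts, h1, h2]

lemma hts_three (p : Iinf × Iinf) (k : ℕ) :
    hts p (5 * k + 3) = (p.2 k : ℝ) * (1 - p.2 k) := by
  have h1 : (5 * k + 3) % 5 = 3 := by omega
  have h2 : (5 * k + 3) / 5 = k := by omega
  simp [hts, h1, h2]

lemma hts_four (p : Iinf × Iinf) (k : ℕ) :
    hts p (5 * k + 4) = (p.2 k : ℝ) * (1 - p.2 k) := by
  have h1 : (5 * k + 4) % 5 = 4 := by omega
  have h2 : (5 * k + 4) / 5 = k := by omega
  simp [hts, h1, h2]

lemma hts_zero_pos (p : Iinf × Iinf) (k : ℕ) : 0 < hts p (5 * k) := by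
  rw [hts_zero]
  have := (p.1 k).2.1
  linarith

lemma hts_two_pos (p : Iinf × Iinf) (k : ℕ) : 0 < hts p (5 * k + 2) := by
  rw [hts_two]
  have := (p.2 k).2.1
  linarith

lemma unit_mul_pos {x : ℝ} (h : 0 < x ∧ x < 1) : 0 < x * (1 - x) :=
  mul_pos h.1 (by linarith [h.2])

lemma unit_mul_zero (x : unitInterval) (h : ¬ (0 < (x : ℝ) ∧ (x : ℝ) < 1)) :
    (x : ℝ) * (1 - x) = 0 := by
  have h1 := x.2.1
  have h2 := x.2.2
  rcases h1.eq_or_lt with h3 | h3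
  · rw [← h3, zero_mul]
  · rcases h2.eq_or_lt with h4 | h4
    · rw [h4, sub_self, mul_zero]
    · exact absurd ⟨h3, h4⟩ h

lemma hts_cases (j : ℕ) : ∃ k, j = 5 * k ∨ j = 5 * k + 1 ∨ j = 5 * k + 2 ∨ j = 5 * k + 3 ∨
    j = 5 * k + 4 := ⟨j / 5, by omega⟩

/-- The key combinatorial property of the profiles. -/
lemma prof_key (q t : Iinf) :
    (¬ IsPreconnected (Pos (prof (hts (q, t)))) ∧
      IsPreconnected (closure (Pos (prof (hts (q, t)))))) ↔
    q ∈ pseudoBoundary ∧ t ∈ pseudoInterior := by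
  set p : Iinf × Iinf := (q, t) with hp
  have h0 := hts_nonneg p
  have h2 := hts_le_two p
  by_cases ht : t ∈ pseudoInterior
  · by_cases hq : q ∈ pseudoInterior
    · have : IsPreconnected (Pos (prof (hts p))) := by
        apply pos_preconnected h0 h2
        intro j
        obtain ⟨k, rfl | rfl | rfl | rfl | rfl⟩ := hts_cases j
        · exact hts_zero_pos _ _
        · rw [hts_one]; exact unit_mul_pos (hq k)
        · exact hts_two_pos _ _
        · rw [hts_three]; exact unit_mul_pos (ht k)
        · rw [hts_four]; exact unit_mul_pos (ht k)
      constructor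
      · exact fun h => absurd this h.1
      · exact fun h => absurd hq h.1
    · refine ⟨fun _ => ⟨hq, ht⟩, fun _ => ⟨?_, ?_⟩⟩
      · obtain ⟨k, hk⟩ := not_forall.1 hq
        exact pos_not_preconnected h0 h2 (hts_zero_pos p k) (hts_two_pos p k)
          (j := 5 * k + 1) (by omega) (by omega) (by rw [hts_one]; exact unit_mul_zero _ hk)
      · apply closure_pos_preconnected h0 h2 (hts_zero_pos p 0)
        intro j
        obtain ⟨k, rfl | rfl | rfl | rfl | rfl⟩ := hts_cases j
        · exact Or.inl (hts_zero_pos _ _)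
        · exact Or.inr (hts_two_pos _ _)
        · exact Or.inl (hts_two_pos _ _)
        · left; rw [hts_three]; exact unit_mul_pos (ht k)
        · left; rw [hts_four]; exact unit_mul_pos (ht k)
  · refine ⟨fun h => ?_, fun h => absurd h.2 ht⟩
    obtain ⟨k, hk⟩ := not_forall.1 ht
    exact absurd h.2 (closure_pos_not_preconnected h0 h2 (hts_two_pos p k)
      (hts_zero_pos p (k + 1)) (j := 5 * k + 3) (by omega) (by omega)
      (by rw [hts_three]; exact unit_mul_zero _ hk) (by rw [hts_four]; exact unit_mul_zero _ hk))

lemma prof_inj {p p' : Iinf × Iinf} (h : prof (hts p) = prof (hts p')) : p = p' := by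
  have hk : ∀ k, hts p k = hts p' k := by
    intro k
    have := congrFun h (1 / ((k : ℝ) + 2))
    rw [prof_node, prof_node] at this
    have h1 : (0 : ℝ) < 1 / ((k : ℝ) + 2) := by positivity
    have h2 : (0 : ℝ) < (1 / 2 : ℝ) ^ k := by positivity
    exact mul_left_cancel₀ h2.ne' (mul_right_cancel₀ h1.ne' this)
  apply Prod.ext
  · funext k
    have := hk (5 * k)
    rw [hts_zero, hts_zero] at this
    exact Subtype.ext (by linarith)
  · funext k
    have := hk (5 * k + 2)
    rw [hts_two, hts_two] at this
    exact Subtype.ext (by linarith)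

end Heights

section Final

lemma exists_chart {X : Type*} [TopologicalSpace X] (m : ℕ) (U : Set X) (hUopen : IsOpen U)
    (e : U ≃ₜ (Set.univ.pi fun _ : Fin (m + 2) => Set.Ioo (-3 : ℝ) 3)) :
    ∃ i : ℝ × (Fin (m + 1) → ℝ) → X, IsOpenEmbedding i := by
  have hball : (Set.univ.pi fun _ : Fin (m + 2) => Set.Ioo (-3 : ℝ) 3) =
      ball (0 : Fin (m + 2) → ℝ) 3 := by
    rw [ball_pi _ (by norm_num)]
    simp [Real.ball_eq_Ioo]
  let e1 : ℝ × (Fin (m + 1) → ℝ) ≃ₜ (Fin (m + 2) → ℝ) :=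
    (Fin.consEquivL ℝ (fun _ : Fin (m + 2) => ℝ)).toHomeomorph
  let ub := OpenPartialHomeomorph.univBall (0 : Fin (m + 2) → ℝ) 3
  have hs : ub.source = univ := OpenPartialHomeomorph.univBall_source _ _
  have htg : ub.target = ball 0 3 := OpenPartialHomeomorph.univBall_target _ (by norm_num)
  let e2 : (Fin (m + 2) → ℝ) ≃ₜ ub.target :=
    ((Homeomorph.Set.univ _).symm.trans (Homeomorph.setCongr hs.symm)).trans
      ub.toHomeomorphSourceTarget
  let e3 : ub.target ≃ₜ U := (Homeomorph.setCongr (htg.trans hball.symm)).trans e.symm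
  exact ⟨fun x => (e3 (e2 (e1 x)) : X),
    hUopen.isOpenEmbedding_subtypeVal.comp ((e1.trans e2).trans e3).isOpenEmbedding⟩

variable {X : Type*} [MetricSpace X] [CompactSpace X] [ConnectedSpace X]
  {V : Type*} [NormedAddCommGroup V] [NormedSpace ℝ V] [Nontrivial V] [ProperSpace V]

/-- The subsets of `X` making up the embedding. -/
def remSet (i : ℝ × V → X) (p : Iinf × Iinf) : Set X := (i '' Body V (prof (hts p)))ᶜ


lemma prof_hts_cont2 : Continuous fun x : (Iinf × Iinf) × ℝ => prof (hts x.1) x.2 :=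
  prof_cont hts_nonneg hts_le_two hts_cont

lemma prof_hts_cont (p : Iinf × Iinf) : Continuous (prof (hts p)) :=
  prof_hts_cont2.comp (Continuous.prodMk_right p)

lemma prof_hts_two (p : Iinf × Iinf) : prof (hts p) 2 = 0 := by
  by_contra h
  have := (prof_supp (hts_nonneg p) (hts_le_two p) 2
    (lt_of_le_of_ne (prof_nonneg (hts_nonneg p) 2) (Ne.symm h))).2
  norm_num at this

lemma remSet_closed {i : ℝ × V → X} (hi : IsOpenEmbedding i) (p : Iinf × Iinf) :
    IsClosed (remSet i p) :=
  (hi.isOpenMap _ (body_isOpen (prof_hts_cont p))).isClosed_compl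

lemma not_mem_body (p : Iinf × Iinf) : ((2 : ℝ), (0 : V)) ∉ Body V (prof (hts p)) := by
  simp [Body, prof_hts_two]

lemma remSet_nonempty {i : ℝ × V → X} (hi : IsOpenEmbedding i) (p : Iinf × Iinf) :
    (remSet i p).Nonempty := by
  refine ⟨i (2, 0), ?_⟩
  rintro ⟨x, hx, h⟩
  rw [hi.injective h] at hx
  exact not_mem_body p hx

lemma remSet_connected {i : ℝ × V → X} (hi : IsOpenEmbedding i) (p : Iinf × Iinf) :
    IsConnected (remSet i p) := by
  refine ⟨remSet_nonempty hi p, ?_⟩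
  have hc := prof_hts_cont p
  have h0 := prof_nonneg (hts_nonneg p)
  have hs := prof_supp (hts_nonneg p) (hts_le_two p)
  exact compl_image_preconnected hi (closure_body_compact hc h0 hs) ⟨_, not_mem_body p⟩
    (compl_body_preconnected hc h0 hs)

/-- The embedding into the hyperspace. -/
def remK {i : ℝ × V → X} (hi : IsOpenEmbedding i) (p : Iinf × Iinf) : Hyper X :=
  ⟨⟨remSet i p, (remSet_closed hi p).isCompact⟩, remSet_nonempty hi p⟩

lemma coe_remK {i : ℝ × V → X} (hi : IsOpenEmbedding i) (p : Iinf × Iinf) :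
    (remK hi p : Set X) = remSet i p := rfl

lemma remK_cont {i : ℝ × V → X} (hi : IsOpenEmbedding i) : Continuous (remK hi) := by
  letI := TopologicalSpace.vietoris X
  rw [TopologicalSpace.NonemptyCompacts.isEmbedding_coe.continuous_iff,
    TopologicalSpace.vietoris.continuous_iff]
  constructor
  · intro O hO
    rw [isOpen_iff_mem_nhds]
    intro p0 hp0
    have hp0 : remSet i p0 ⊆ O := hp0
    have hG : IsOpen {x : (Iinf × Iinf) × (ℝ × V) | ‖x.2.2‖ < prof (hts x.1) x.2.1} := by
      apply isOpen_lt (by fun_prop)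
      exact prof_hts_cont2.comp (f := fun x : (Iinf × Iinf) × (ℝ × V) => (x.1, x.2.1))
        (by fun_prop)
    have hG' : IsOpen {x : (Iinf × Iinf) × X | x.2 ∈ i '' Body V (prof (hts x.1))} := by
      convert (IsOpenEmbedding.id.prodMap hi).isOpenMap _ hG using 1
      ext ⟨p, x⟩
      constructor
      · rintro ⟨w, hw, rfl⟩
        exact ⟨(p, w), hw, rfl⟩
      · rintro ⟨⟨p, w⟩, hw, h⟩
        obtain ⟨rfl, rfl⟩ := Prod.mk.inj h
        exact ⟨w, hw, rfl⟩
    have := hO.isClosed_compl.isCompact.eventually_forall_of_forall_eventually (x₀ := p0)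
      (P := fun p x => x ∈ i '' Body V (prof (hts p))) (by
        intro x hx
        apply hG'.mem_nhds
        by_contra h
        exact hx (hp0 h))
    filter_upwards [this] with p hp
    intro x hx
    by_contra hxO
    exact hx (hp x hxO)
  · intro F hF
    rw [← isOpen_compl_iff, isOpen_iff_mem_nhds]
    intro p0 hp0
    obtain ⟨x, hx, hxF⟩ := not_subset.1 (show ¬ remSet i p0 ⊆ F from hp0)
    by_cases hr : x ∈ range i
    · obtain ⟨⟨y, z⟩, rfl⟩ := hr
      obtain ⟨v, hv, hz⟩ := exists_dir z
      have hyz : prof (hts p0) y ≤ ‖z‖ := by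
        by_contra! h
        exact hx ⟨(y, z), h, rfl⟩
      let s : Iinf × Iinf → X := fun p => i (y, max ‖z‖ (prof (hts p) y) • v)
      have hsc : Continuous s := by
        have h1 : Continuous fun p => prof (hts p) y :=
          prof_hts_cont2.comp (Continuous.prodMk_left y)
        exact hi.continuous.comp (by fun_prop)
      have hs0 : s p0 = i (y, z) := by
        simp only [s]
        rw [max_eq_left hyz, ← hz]
      have hsF : ∀ᶠ p in 𝓝 p0, s p ∈ Fᶜ :=
        hsc.continuousAt.eventually_mem (hF.isOpen_compl.mem_nhds (by rw [hs0]; exact hxF))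
      filter_upwards [hsF] with p hp
      refine fun hsub : remSet i p ⊆ F => hp (hsub ?_)
      rintro ⟨w, hw, h⟩
      rw [hi.injective h] at hw
      have hw : ‖max ‖z‖ (prof (hts p) y) • v‖ < prof (hts p) y := hw
      rw [norm_smul, hv, mul_one, Real.norm_of_nonneg (le_max_of_le_left (norm_nonneg _))] at hw
      exact absurd (le_max_right _ _) (not_le.2 hw)
    · apply Filter.univ_mem'
      intro p
      refine fun hsub : remSet i p ⊆ F => hxF (hsub ?_)
      rintro ⟨w, _, h⟩
      exact hr ⟨w, h⟩

lemma remK_inj {i : ℝ × V → X} (hi : IsOpenEmbedding i) : Function.Injective (remK hi) := by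
  intro p p' h
  have h1 : remSet i p = remSet i p' := congrArg (fun K : Hyper X => (K : Set X)) h
  have h2 := hi.injective.image_injective (compl_injective h1)
  apply prof_inj
  funext y
  have key : ∀ r : ℝ, 0 ≤ r → (r < prof (hts p) y ↔ r < prof (hts p') y) := by
    intro r hr
    obtain ⟨v, hv⟩ := exists_norm_eq V hr
    have := Set.ext_iff.1 h2 (y, v)
    simpa [Body, hv] using this
  apply le_antisymm
  · by_contra! hlt
    exact lt_irrefl _ ((key _ (prof_nonneg (hts_nonneg p') y)).1 hlt)
  · by_contra! hlt
    exact lt_irrefl _ ((key _ (prof_nonneg (hts_nonneg p) y)).2 hlt)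

lemma remK_iff {i : ℝ × V → X} (hi : IsOpenEmbedding i) (q t : Iinf) :
    remK hi (q, t) ∈ SepSet X ∩ CBSet X ↔ q ∈ pseudoBoundary ∧ t ∈ pseudoInterior := by
  rw [← prof_key]
  set p : Iinf × Iinf := (q, t)
  have hc := prof_hts_cont p
  have h0 := prof_nonneg (hts_nonneg p)
  have hs := prof_supp (hts_nonneg p) (hts_le_two p)
  have hne : (Pos (prof (hts p))).Nonempty :=
    ⟨_, (node_mem_pos (hts_nonneg p) (hts_le_two p) _).2 (hts_zero_pos p 0)⟩
  have hbne : (Body V (prof (hts p))).Nonempty := by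
    rw [← fst_body (V := V)] at hne
    exact hne.of_image
  have hsep : remK hi p ∈ SepSet X ↔ ¬ IsPreconnected (Pos (prof (hts p))) := by
    change ¬ IsPreconnected ((remSet i p)ᶜ) ↔ _
    rw [remSet, compl_compl, hi.isInducing.isPreconnected_image, body_preconnected_iff hc]
  have hcb : remK hi p ∈ CBSet X ↔ IsPreconnected (closure (Pos (prof (hts p)))) := by
    change (IsConnected (remSet i p) ∧ remSet i p ≠ univ ∧ IsConnected (frontier (remSet i p))) ↔ _
    have hfr : frontier (remSet i p) = i '' frontier (Body V (prof (hts p))) := by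
      rw [remSet, frontier_compl]
      exact frontier_image_open hi (body_isOpen hc) (closure_body_compact hc h0 hs)
    have hpre : IsPreconnected (frontier (remSet i p)) ↔
        IsPreconnected (closure (Pos (prof (hts p)))) := by
      rw [hfr, hi.isInducing.isPreconnected_image, frontier_body_preconnected_iff hc h0 hs hne]
    have hfne : (frontier (remSet i p)).Nonempty := by
      rw [hfr, frontier_body hc h0]
      obtain ⟨y, hy⟩ := hne
      obtain ⟨v, hv⟩ := exists_norm_eq V (h0 y)
      exact ⟨_, (y, v), ⟨hv, subset_closure hy⟩, rfl⟩
    have hpr : remSet i p ≠ univ := by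
      rw [remSet, Ne, compl_univ_iff]
      exact (hbne.image i).ne_empty
    rw [← hpre]
    exact ⟨fun h => h.2.2.isPreconnected, fun h => ⟨remSet_connected hi p, hpr, hfne, h⟩⟩
  rw [mem_inter_iff, hsep, hcb]

end Final

/-- If `X` is a nondegenerate continuum containing the open cube
`(-3,3)ⁿ` (`2 ≤ n < ∞`) as an open subset, then there is an embedding
`Φ : I^∞ × I^∞ → C(X)` such that `Φ((q_k),(t_k)) ∈ S(X) ∩ CB(X)` iff
`((q_k),(t_k)) ∈ ∂(I^∞) × (0,1)^∞`. -/
theorem exists_embedding_phi (X : Type*) [MetricSpace X] [CompactSpace X]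
    [ConnectedSpace X] [Nontrivial X] (n : ℕ) (hn : 2 ≤ n) (U : Set X)
    (hUopen : IsOpen U)
    (hUcube : Nonempty (U ≃ₜ (Set.univ.pi fun _ : Fin n => Set.Ioo (-3 : ℝ) 3))) :
    ∃ Φ : Iinf × Iinf → ↥(CSet X), IsEmbedding Φ ∧
      ∀ q t : Iinf, ((Φ (q, t) : Hyper X) ∈ SepSet X ∩ CBSet X ↔
        q ∈ pseudoBoundary ∧ t ∈ pseudoInterior) := by
  obtain ⟨e⟩ := hUcube
  obtain ⟨m, rfl⟩ : ∃ m, n = m + 2 := ⟨n - 2, by omega⟩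
  obtain ⟨i, hi⟩ := exists_chart m U hUopen e
  refine ⟨fun p => ⟨remK hi p, remSet_connected hi p⟩, ?_, fun q t => remK_iff hi q t⟩
  have hcont : Continuous (fun p => (⟨remK hi p, remSet_connected hi p⟩ : ↥(CSet X))) :=
    (remK_cont hi).subtype_mk _
  exact (hcont.isClosedEmbedding fun p p' h =>
    remK_inj hi (congrArg Subtype.val h)).isEmbedding
end
end

section
/- If Y is a π-n-Euclidean space with n ≥ 2, then Y contains no free arcs. -/
open Set Topology Metric

noncomputable section

/-- There is no continuous injection from `ℝⁿ` to `ℝ` for `n ≥ 2`. -/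
theorem no_cont_inj (n : ℕ) (hn : 2 ≤ n) (f : (Fin n → ℝ) → ℝ) (hf : Continuous f)
    (hi : Function.Injective f) : False := by
  have key : ∀ a b : Fin n → ℝ, f a < f b → False := by
    intro a b hab
    obtain ⟨m, h1, h2⟩ := exists_between hab
    obtain ⟨p, -, hp⟩ := (isPreconnected_univ (α := Fin n → ℝ)).intermediate_value
      (mem_univ a) (mem_univ b) hf.continuousOn ⟨h1.le, h2.le⟩
    have hr : 1 < Module.rank ℝ (Fin n → ℝ) := by
      rw [rank_fin_fun]
      exact_mod_cast hn
    have hc := (isConnected_compl_singleton_of_one_lt_rank hr p).isPreconnected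
    have ha : a ∈ ({p} : Set (Fin n → ℝ))ᶜ := by
      rintro rfl
      exact h1.ne hp
    have hb : b ∈ ({p} : Set (Fin n → ℝ))ᶜ := by
      rintro rfl
      exact h2.ne hp.symm
    obtain ⟨q, hq, hqm⟩ := hc.intermediate_value ha hb hf.continuousOn ⟨h1.le, h2.le⟩
    exact hq (hi (hqm.trans hp.symm))
  have hne : f 0 ≠ f 1 := by
    intro h
    have := congrFun (hi h) ⟨0, by omega⟩
    simp at this
  rcases lt_or_gt_of_ne hne with h | h
  · exact key _ _ h
  · exact key _ _ h

/-- A π-`n`-Euclidean space with `n ≥ 2` contains no free arcs. -/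
theorem piEuclidean_no_free_arcs (Y : Type*) [TopologicalSpace Y]
    (n : ℕ) (hn : 2 ≤ n) (hE : PiEuclidean Y n) :
    ∀ A : Set Y, ¬ IsFreeArc A := by
  rintro A ⟨h, hV⟩
  obtain ⟨B, hB, hπ⟩ := hE
  have hne : (A \ {((h 0 : A) : Y), ((h 1 : A) : Y)}).Nonempty := by
    let t : unitInterval := ⟨1 / 2, by norm_num, by norm_num⟩
    refine ⟨h t, (h t).2, ?_⟩
    rintro (h0 | h0)
    · have := congrArg Subtype.val (h.injective (Subtype.ext h0))
      norm_num [t] at this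
    · have := congrArg Subtype.val (h.injective (Subtype.ext h0))
      norm_num [t] at this
  obtain ⟨U, hU, hUV⟩ := hπ _ hV hne
  obtain ⟨-, -, ⟨e⟩⟩ := hB U hU
  have hUA : U ⊆ A := fun x hx => (hUV hx).1
  refine no_cont_inj n hn (fun x => (h.symm (Set.inclusion hUA (e.symm x)) : ℝ)) ?_ ?_
  · exact continuous_subtype_val.comp (h.symm.continuous.comp
      ((continuous_inclusion hUA).comp e.symm.continuous))
  · exact Subtype.val_injective.comp (h.symm.injective.comp
      ((Set.inclusion_injective hUA).comp e.symm.injective))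
end
end

section
/- If X is a nondegenerate Peano continuum without free arcs, then every arc A ⊆ X is nowhere dense in X; consequently Bd(A) = A is connected and A ∈ CB(X). -/
open Set Topology Metric

noncomputable section

theorem arc_interior_empty {X : Type*} [MetricSpace X] (hfa : ∀ A : Set X, ¬ IsFreeArc A)
    {A : Set X} (h : unitInterval ≃ₜ A) : interior A = ∅ := by
  by_contra hne
  obtain ⟨x, hx⟩ := nonempty_iff_ne_empty.2 hne
  set f : unitInterval → X := fun t => (h t : X) with hf
  have hfc : Continuous f := continuous_subtype_val.comp h.continuous
  have hfi : Function.Injective f := Subtype.val_injective.comp h.injective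
  have hV : IsOpen (f ⁻¹' interior A) := isOpen_interior.preimage hfc
  have hVn : (f ⁻¹' interior A).Nonempty :=
    ⟨h.symm ⟨x, interior_subset hx⟩, by simpa [hf] using hx⟩
  obtain ⟨a, b, hab, hsub⟩ := hV.exists_Ioo_subset hVn
  have hab' : (a : ℝ) < b := hab
  have ha := a.2.1
  have hb := b.2.2
  let k : unitInterval → unitInterval := fun t =>
    ⟨a + t * (b - a), by have := t.2.1; nlinarith, by have := t.2.2; nlinarith⟩
  have hkc : Continuous k := by
    apply Continuous.subtype_mk
    fun_prop
  have hki : Function.Injective k := by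
    intro s t hst
    have h1 : (a : ℝ) + s * (b - a) = a + t * (b - a) := congrArg Subtype.val hst
    have h2 : (b : ℝ) - a ≠ 0 := by linarith
    apply Subtype.ext
    exact mul_right_cancel₀ h2 (by linarith)
  have hk0 : k 0 = a := by apply Subtype.ext; simp [k]
  have hk1 : k 1 = b := by apply Subtype.ext; simp [k]
  have hg : IsClosedEmbedding (f ∘ k) := (hfc.comp hkc).isClosedEmbedding (hfi.comp hki)
  apply hfa (range (f ∘ k))
  refine ⟨hg.isEmbedding.toHomeomorph, ?_⟩
  have heq : range (f ∘ k) \ {((hg.isEmbedding.toHomeomorph 0 : range (f ∘ k)) : X),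
      ((hg.isEmbedding.toHomeomorph 1 : range (f ∘ k)) : X)}
      = interior A ∩ (f '' (Ioo a b)ᶜ)ᶜ := by
    have e0 : ((hg.isEmbedding.toHomeomorph 0 : range (f ∘ k)) : X) = f a := by
      simp [hk0]
    have e1 : ((hg.isEmbedding.toHomeomorph 1 : range (f ∘ k)) : X) = f b := by
      simp [hk1]
    rw [e0, e1]
    ext y
    constructor
    · rintro ⟨⟨t, rfl⟩, hy⟩
      have hmem : k t ∈ Ioo a b := by
        have h0 : t ≠ 0 := by
          rintro rfl
          exact hy (Or.inl (congrArg f hk0))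
        have h1 : t ≠ 1 := by
          rintro rfl
          exact hy (Or.inr (congrArg f hk1))
        have h0' : (0 : ℝ) < t := unitInterval.pos_iff_ne_zero.2 h0
        have h1' : (t : ℝ) < 1 := unitInterval.lt_one_iff_ne_one.2 h1
        constructor
        · show (a : ℝ) < a + t * (b - a)
          nlinarith
        · show (a : ℝ) + t * (b - a) < b
          nlinarith
      refine ⟨hsub hmem, ?_⟩
      rintro ⟨s, hs, hst⟩
      exact hs (hfi hst ▸ hmem)
    · rintro ⟨hy, hy2⟩
      obtain ⟨s, rfl⟩ : ∃ s, f s = y := ⟨h.symm ⟨y, interior_subset hy⟩, by simp [hf]⟩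
      have hs : s ∈ Ioo a b := by
        by_contra hs
        exact hy2 ⟨s, hs, rfl⟩
      have hs1 : (a : ℝ) < s := hs.1
      have hs2 : (s : ℝ) < b := hs.2
      have hd : (0 : ℝ) < b - a := by linarith
      refine ⟨⟨⟨(s - a) / (b - a), div_nonneg (by linarith) hd.le,
        (div_le_one hd).2 (by linarith)⟩, ?_⟩, ?_⟩
      · show f (k _) = f s
        congr 1
        apply Subtype.ext
        show (a : ℝ) + (s - a) / (b - a) * (b - a) = s
        rw [div_mul_cancel₀ _ hd.ne']
        ring
      · rintro (hh | hh)
        · exact hs.1.ne' (hfi hh)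
        · exact hs.2.ne (hfi hh)
  rw [heq]
  exact isOpen_interior.inter
    ((isOpen_Ioo.isClosed_compl.isCompact.image hfc).isClosed.isOpen_compl)

/-- In a nondegenerate Peano continuum without free arcs, every arc is
nowhere dense; consequently its boundary equals the arc itself (hence is connected) and
the arc belongs to `CB(X)`. -/
theorem arc_nowhereDense_mem_CBSet (X : Type*) [MetricSpace X] [CompactSpace X]
    [ConnectedSpace X] [Nontrivial X] [LocallyConnectedSpace X]
    (hfa : ∀ A : Set X, ¬ IsFreeArc A) :
    ∀ A : Set X, IsArc A →
      IsNowhereDense A ∧ frontier A = A ∧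
        ∀ B : Hyper X, (B : Set X) = A → B ∈ CBSet X := by
  intro A hA
  obtain ⟨h⟩ := hA
  have key : interior A = ∅ := arc_interior_empty hfa h
  have hcomp : IsCompact A := isCompact_iff_compactSpace.2 h.compactSpace
  have hcl : IsClosed A := hcomp.isClosed
  have hconn : IsConnected A := isConnected_iff_connectedSpace.2
    (h.surjective.connectedSpace h.continuous)
  have hfr : frontier A = A := by rw [hcl.frontier_eq, key, diff_empty]
  refine ⟨hcl.isNowhereDense_iff.2 key, hfr, ?_⟩
  intro B hB
  refine ⟨by rw [hB]; exact hconn, ?_, by rw [hB, hfr]; exact hconn⟩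
  rw [hB]
  rintro rfl
  rw [interior_univ] at key
  exact (univ_nonempty (α := X)).ne_empty key
end
end

section
/- For the unit interval X = I = [0,1], the space CB(I) with the Hausdorff metric is homeomorphic to the real line ℝ; in particular, CB(I) is an absolute G_δ-set. Concretely, CB(I) consists of the intervals [a,b] ⊆ [0,1] with (a,b) ≠ (0,1) such that a = 0, b = 1, or a = b. -/
open Set Topology Metric

noncomputable section

/-! ### Part 1: description of `CB(I)` -/

lemma mem_CBSet_iff (A : Hyper unitInterval) : A ∈ CBSet unitInterval ↔
      ∃ a b : unitInterval, a ≤ b ∧ (A : Set unitInterval) = Set.Icc a b ∧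
        ¬(a = 0 ∧ b = 1) ∧ (a = 0 ∨ b = 1 ∨ a = b) := by
  constructor
  · rintro ⟨hc, hne, hf⟩
    have hA := eq_Icc_of_connected_compact hc A.isCompact
    set a := sInf (A : Set unitInterval)
    set b := sSup (A : Set unitInterval)
    have hab : a ≤ b := by
      have := hc.nonempty
      rw [hA] at this
      exact Set.nonempty_Icc.1 this
    refine ⟨a, b, hab, hA, ?_, ?_⟩
    · rintro ⟨h0, h1⟩
      apply hne
      rw [hA, h0, h1]
      ext x
      simp [unitInterval.nonneg', unitInterval.le_one']
    · by_contra hcon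
      push Not at hcon
      obtain ⟨h0, h1, h2⟩ := hcon
      have hlt : a < b := lt_of_le_of_ne hab h2
      rw [hA] at hf
      have ha : a ∈ frontier (Set.Icc a b) := by
        rw [isClosed_Icc.frontier_eq]
        refine ⟨⟨le_rfl, hab⟩, fun h => ?_⟩
        have h' := interior_mono (Set.Icc_subset_Ici_self) h
        rw [interior_Ici' ⟨(0 : unitInterval), unitInterval.pos_iff_ne_zero.2 h0⟩] at h'
        exact absurd h' (by simp)
      have hb : b ∈ frontier (Set.Icc a b) := by
        rw [isClosed_Icc.frontier_eq]
        refine ⟨⟨hab, le_rfl⟩, fun h => ?_⟩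
        have h' := interior_mono (Set.Icc_subset_Iic_self) h
        rw [interior_Iic' ⟨(1 : unitInterval), unitInterval.lt_one_iff_ne_one.2 h1⟩] at h'
        exact absurd h' (by simp)
      obtain ⟨c, hc1, hc2⟩ := exists_between hlt
      have hcf := hf.isPreconnected.Icc_subset ha hb ⟨hc1.le, hc2.le⟩
      rw [isClosed_Icc.frontier_eq] at hcf
      exact hcf.2 (interior_maximal Set.Ioo_subset_Icc_self isOpen_Ioo ⟨hc1, hc2⟩)
  · rintro ⟨a, b, hab, hA, hn, h⟩
    refine ⟨?_, ?_, ?_⟩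
    · rw [hA]; exact isConnected_Icc hab
    · intro hu
      apply hn
      rw [hA] at hu
      have h0 : (0 : unitInterval) ∈ Set.Icc a b := by rw [hu]; trivial
      have h1 : (1 : unitInterval) ∈ Set.Icc a b := by rw [hu]; trivial
      exact ⟨le_antisymm h0.1 unitInterval.nonneg', le_antisymm unitInterval.le_one' h1.2⟩
    · rw [hA]
      rcases h with h | h | h
      · have hb : b ≠ 1 := fun hb => hn ⟨h, hb⟩
        have : Set.Icc a b = Set.Iic b := by
          ext x; simp [h, unitInterval.nonneg']
        rw [this, frontier_Iic' ⟨(1 : unitInterval), unitInterval.lt_one_iff_ne_one.2 hb⟩]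
        exact isConnected_singleton
      · have ha : a ≠ 0 := fun ha => hn ⟨ha, h⟩
        have : Set.Icc a b = Set.Ici a := by
          ext x; simp [h, unitInterval.le_one']
        rw [this, frontier_Ici' ⟨(0 : unitInterval), unitInterval.pos_iff_ne_zero.2 ha⟩]
        exact isConnected_singleton
      · rw [h, Set.Icc_self, isClosed_singleton.frontier_eq, interior_singleton]
        simpa using isConnected_singleton

/-! ### Part 2: the parametrization -/

/-- Nonempty compact interval as the image of `I` under clamping. -/
def clampSet (p : unitInterval × unitInterval) : Hyper unitInterval :=
  TopologicalSpace.NonemptyCompacts.map (fun t => p.1 ⊔ (p.2 ⊓ t)) (by fun_prop) ⊤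

lemma coe_clampSet {a b : unitInterval} (h : a ≤ b) :
    (clampSet (a, b) : Set unitInterval) = Set.Icc a b := by
  ext x
  simp only [clampSet, TopologicalSpace.NonemptyCompacts.coe_map,
    TopologicalSpace.NonemptyCompacts.coe_top, Set.image_univ, Set.mem_range, Set.mem_Icc]
  constructor
  · rintro ⟨y, rfl⟩
    exact ⟨le_sup_left, sup_le h inf_le_left⟩
  · rintro ⟨h1, h2⟩
    exact ⟨x, by rw [inf_eq_right.2 h2, sup_eq_right.2 h1]⟩

lemma continuous_clampSet : Continuous clampSet := by
  unfold clampSet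
  exact Continuous.nonemptyCompacts_map' (f := fun _ => ⊤)
    (g := fun (p : unitInterval × unitInterval) t => p.1 ⊔ (p.2 ⊓ t))
    continuous_const (by fun_prop)

/-- The left endpoint. -/
def loFun (A : Hyper unitInterval) : ℝ := infDist 0 (A : Set unitInterval)

/-- The right endpoint. -/
def hiFun (A : Hyper unitInterval) : ℝ := 1 - infDist 1 (A : Set unitInterval)

lemma continuous_loFun : Continuous loFun :=
  (lipschitz_infDist_set (0 : unitInterval)).continuous

lemma continuous_hiFun : Continuous hiFun :=
  continuous_const.sub (lipschitz_infDist_set (1 : unitInterval)).continuous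

lemma loFun_eq {A : Hyper unitInterval} {a b : unitInterval} (hab : a ≤ b)
    (hA : (A : Set unitInterval) = Set.Icc a b) : loFun A = a := by
  unfold loFun
  rw [hA]
  apply le_antisymm
  · have := infDist_le_dist_of_mem (x := (0 : unitInterval)) (Set.left_mem_Icc.2 hab)
    rw [Subtype.dist_eq, Real.dist_eq] at this
    simpa [abs_of_nonneg a.2.1] using this
  · rw [le_infDist (Set.nonempty_Icc.2 hab)]
    intro y hy
    rw [Subtype.dist_eq, Real.dist_eq]
    simpa [abs_of_nonneg y.2.1] using hy.1

lemma hiFun_eq {A : Hyper unitInterval} {a b : unitInterval} (hab : a ≤ b)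
    (hA : (A : Set unitInterval) = Set.Icc a b) : hiFun A = b := by
  unfold hiFun
  rw [hA]
  have : infDist 1 (Set.Icc a b) = 1 - (b : ℝ) := by
    apply le_antisymm
    · have := infDist_le_dist_of_mem (x := (1 : unitInterval)) (Set.right_mem_Icc.2 hab)
      rw [Subtype.dist_eq, Real.dist_eq] at this
      simpa [abs_of_nonneg (sub_nonneg.2 b.2.2)] using this
    · rw [le_infDist (Set.nonempty_Icc.2 hab)]
      intro y hy
      rw [Subtype.dist_eq, Real.dist_eq]
      have h2 : (y : ℝ) ≤ b := hy.2
      rw [Set.Icc.coe_one, abs_of_nonneg (sub_nonneg.2 y.2.2)]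
      linarith
  rw [this]; ring

/-- The left endpoint of the interval with parameter `s`. -/
def loP (s : ℝ) : unitInterval := Set.projIcc 0 1 zero_le_one (min s (2 - s))

/-- The right endpoint of the interval with parameter `s`. -/
def hiP (s : ℝ) : unitInterval := Set.projIcc 0 1 zero_le_one |s|

lemma coe_loP (s : ℝ) : (loP s : ℝ) = max 0 (min 1 (min s (2 - s))) := by
  simp [loP, Set.coe_projIcc]

lemma coe_hiP (s : ℝ) : (hiP s : ℝ) = max 0 (min 1 |s|) := by
  simp [hiP, Set.coe_projIcc]

lemma continuous_loP : Continuous loP := by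
  unfold loP
  exact continuous_projIcc.comp (by fun_prop)

lemma continuous_hiP : Continuous hiP := by
  unfold hiP
  exact continuous_projIcc.comp (by fun_prop)

lemma param_cases {s : ℝ} (h1 : -1 < s) (h2 : s < 2) :
    (s < 0 ∧ (loP s : ℝ) = 0 ∧ (hiP s : ℝ) = -s) ∨
    (0 ≤ s ∧ s ≤ 1 ∧ (loP s : ℝ) = s ∧ (hiP s : ℝ) = s) ∨
    (1 < s ∧ (loP s : ℝ) = 2 - s ∧ (hiP s : ℝ) = 1) := by
  rw [coe_loP, coe_hiP]
  rcases lt_or_ge s 0 with h | h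
  · left
    rw [abs_of_neg h]
    refine ⟨h, ?_, ?_⟩ <;> grind
  · right
    rw [abs_of_nonneg h]
    rcases le_or_gt s 1 with h' | h'
    · left
      refine ⟨h, h', ?_, ?_⟩ <;> grind
    · right
      refine ⟨h', ?_, ?_⟩ <;> grind

lemma loP_le_hiP {s : ℝ} (h1 : -1 < s) (h2 : s < 2) : loP s ≤ hiP s := by
  rw [← Subtype.coe_le_coe]
  rcases param_cases h1 h2 with h | h | h <;> grind

lemma clamp_mem {s : ℝ} (h1 : -1 < s) (h2 : s < 2) :
    clampSet (loP s, hiP s) ∈ CBSet unitInterval := by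
  rw [mem_CBSet_iff]
  refine ⟨loP s, hiP s, loP_le_hiP h1 h2, coe_clampSet (loP_le_hiP h1 h2), ?_, ?_⟩
  · simp only [Subtype.ext_iff, Set.Icc.coe_zero, Set.Icc.coe_one]
    rcases param_cases h1 h2 with h | h | h <;> grind
  · simp only [Subtype.ext_iff, Set.Icc.coe_zero, Set.Icc.coe_one]
    rcases param_cases h1 h2 with h | h | h <;> grind

/-- The inverse parametrization in terms of endpoints. -/
def invP (a b : ℝ) : ℝ := 2 * a - b + 3 * (b - a) * a / (a + 1 - b)

lemma invP_left (b : ℝ) : invP 0 b = -b := by simp [invP]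

lemma invP_diag (a : ℝ) : invP a a = a := by simp [invP]; ring

lemma invP_right {a : ℝ} (h : a ≠ 0) : invP a 1 = 2 - a := by
  have h1 : a + 1 - 1 = a := by ring
  rw [invP, h1, mul_div_assoc, div_self h]; ring

lemma invP_param {s : ℝ} (h1 : -1 < s) (h2 : s < 2) : invP (loP s) (hiP s) = s := by
  rcases param_cases h1 h2 with ⟨_, h, h'⟩ | ⟨_, _, h, h'⟩ | ⟨_, h, h'⟩
  · rw [h, h', invP_left]; ring
  · rw [h, h', invP_diag]
  · rw [h, h', invP_right (by linarith)]; ring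

lemma invP_spec {a b : unitInterval} (hn : ¬(a = 0 ∧ b = 1))
    (h : a = 0 ∨ b = 1 ∨ a = b) :
    -1 < invP a b ∧ invP a b < 2 ∧ loP (invP a b) = a ∧ hiP (invP a b) = b := by
  have ha0 := a.2.1
  have ha1 := a.2.2
  have hb0 := b.2.1
  have hb1 := b.2.2
  simp only [Subtype.ext_iff, Set.Icc.coe_zero, Set.Icc.coe_one] at *
  rw [coe_loP, coe_hiP]
  rcases h with h | h | h
  · rw [h, invP_left, abs_neg, abs_of_nonneg hb0]
    refine ⟨?_, ?_, ?_, ?_⟩ <;> grind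
  · have : (a : ℝ) ≠ 0 := fun h0 => hn ⟨h0, h⟩
    rw [h, invP_right this, abs_of_nonneg (by linarith)]
    refine ⟨?_, ?_, ?_, ?_⟩ <;> grind
  · rw [← h, invP_diag, abs_of_nonneg ha0]
    refine ⟨?_, ?_, ?_, ?_⟩ <;> grind

/-- The inverse parametrization. -/
def param (A : Hyper unitInterval) : ℝ := invP (loFun A) (hiFun A)

lemma param_mem {A : Hyper unitInterval} (hA : A ∈ CBSet unitInterval) :
    -1 < param A ∧ param A < 2 ∧ clampSet (loP (param A), hiP (param A)) = A := by
  obtain ⟨a, b, hab, hE, hn, h⟩ := (mem_CBSet_iff A).1 hA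
  unfold param
  rw [loFun_eq hab hE, hiFun_eq hab hE]
  obtain ⟨h1, h2, h3, h4⟩ := invP_spec hn h
  refine ⟨h1, h2, ?_⟩
  rw [h3, h4]
  apply SetLike.coe_injective
  rw [coe_clampSet hab, hE]

lemma continuous_param : Continuous (fun A : CBSet unitInterval => param A) := by
  have hl : Continuous (fun A : CBSet unitInterval => loFun A) :=
    continuous_loFun.comp continuous_subtype_val
  have hh : Continuous (fun A : CBSet unitInterval => hiFun A) :=
    continuous_hiFun.comp continuous_subtype_val
  unfold param invP
  refine Continuous.add (by fun_prop) (Continuous.div (by fun_prop) (by fun_prop) ?_)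
  rintro ⟨A, hA⟩
  obtain ⟨a, b, hab, hE, hn, h⟩ := (mem_CBSet_iff A).1 hA
  simp only [loFun_eq hab hE, hiFun_eq hab hE]
  intro h0
  apply hn
  have ha0 := a.2.1
  have hb1 := b.2.2
  simp only [Subtype.ext_iff, Set.Icc.coe_zero, Set.Icc.coe_one]
  constructor <;> linarith

lemma ball_iff (s : ℝ) : s ∈ ball (1 / 2 : ℝ) (3 / 2) ↔ -1 < s ∧ s < 2 := by
  rw [Real.ball_eq_Ioo, Set.mem_Ioo]
  norm_num

/-- `CB(I)` is homeomorphic to the open interval `(-1, 2)`. -/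
def homeoBall : CBSet unitInterval ≃ₜ ball (1 / 2 : ℝ) (3 / 2) where
  toFun A := ⟨param A, (ball_iff _).2 ⟨(param_mem A.2).1, (param_mem A.2).2.1⟩⟩
  invFun s := ⟨clampSet (loP s, hiP s),
    clamp_mem ((ball_iff _).1 s.2).1 ((ball_iff _).1 s.2).2⟩
  left_inv A := Subtype.ext (param_mem A.2).2.2
  right_inv s := by
    have h := (ball_iff _).1 s.2
    have hab := loP_le_hiP h.1 h.2
    apply Subtype.ext
    change param (clampSet (loP s, hiP s)) = s
    unfold param
    rw [loFun_eq hab (coe_clampSet hab), hiFun_eq hab (coe_clampSet hab), invP_param h.1 h.2]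
  continuous_toFun := continuous_param.subtype_mk _
  continuous_invFun := Continuous.subtype_mk (continuous_clampSet.comp
    ((continuous_loP.comp continuous_subtype_val).prodMk
      (continuous_hiP.comp continuous_subtype_val))) _

/-- The open interval `(-1, 2)` is homeomorphic to `ℝ`. -/
def homeoReal : CBSet unitInterval ≃ₜ ℝ :=
  homeoBall.trans <| ((Homeomorph.setCongr
    (OpenPartialHomeomorph.univBall_target (1 / 2 : ℝ) (r := 3 / 2) (by norm_num)).symm).trans
    (OpenPartialHomeomorph.univBall (1 / 2 : ℝ) (3 / 2)).toHomeomorphSourceTarget.symm).trans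
    ((Homeomorph.setCongr (OpenPartialHomeomorph.univBall_source (1 / 2 : ℝ) (3 / 2))).trans
      (Homeomorph.Set.univ ℝ))

/-- For `I = [0,1]`, `CB(I)` consists exactly of the subintervals
`[a,b]` with `(a,b) ≠ (0,1)` such that `a = 0`, `b = 1` or `a = b`; with the Hausdorff
metric it is homeomorphic to `ℝ`, in particular it is an absolute `G_δ`-set (Polish). -/
theorem CBSet_unitInterval :
    (∀ A : Hyper unitInterval, A ∈ CBSet unitInterval ↔
      ∃ a b : unitInterval, a ≤ b ∧ (A : Set unitInterval) = Set.Icc a b ∧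
        ¬(a = 0 ∧ b = 1) ∧ (a = 0 ∨ b = 1 ∨ a = b)) ∧
      Nonempty (↥(CBSet unitInterval) ≃ₜ ℝ) ∧
      PolishSpace ↥(CBSet unitInterval) := by
  exact ⟨mem_CBSet_iff, ⟨homeoReal⟩, homeoReal.isClosedEmbedding.polishSpace⟩
end
end
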